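/- arXiv:1503.08573 — 3 statements merged into one kernel-verified Lean document; each statement's English description precedes it below -/
import Mathlib

section
/- For every n ≥ 0, the number of Gessel walks of length 2n starting and ending at the origin equals 16^n·(5/6)_n·(1/2)_n / ((5/3)_n·(2)_n), where (a)_n = a(a+1)···(a+n−1) is the ascending factorial; moreover q(0,0;2n+1) = 0 for every n ≥ 0. -/
/-- Number of Gessel walks of `n` steps starting at the origin, staying in the quadrant
`ℕ²`, and ending at `(i,j)`. The steps are `(1,0), (1,1), (-1,0), (-1,-1)`; a walk of
length `n+1` ending at `(i,j)` is obtained by appending a step to a walk of length `n`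
ending at the corresponding previous (quadrant) position. -/
def gesselCount : ℕ → ℕ → ℕ → ℕ
  | 0, i, j => if i = 0 ∧ j = 0 then 1 else 0
  | n+1, i, j =>
      (if 1 ≤ i then gesselCount n (i-1) j else 0) +
      (if 1 ≤ i ∧ 1 ≤ j then gesselCount n (i-1) (j-1) else 0) +
      gesselCount n (i+1) j + gesselCount n (i+1) (j+1)

section GeneratingFunctions

open PowerSeries

/-- The diagonal `∑ fₙ(t) uⁿ ↦ ∑ fₙ(t) tⁿ` of a power series with power series coefficients. -/
noncomputable def diagonalHom : ℚ⟦X⟧⟦X⟧ →+* ℚ⟦X⟧ where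
  toFun F := PowerSeries.mk fun n => ∑ k ∈ Finset.HasAntidiagonal.antidiagonal n,
    coeff k.1 (coeff k.2 F)
  map_zero' := by ext; simp
  map_one' := by
    ext n
    rw [coeff_mk, coeff_one]
    split_ifs with h
    · simp [h]
    · refine Finset.sum_eq_zero fun k hk => ?_
      rw [coeff_one]
      split_ifs with h2
      · rw [coeff_one, if_neg]
        rw [Finset.HasAntidiagonal.mem_antidiagonal] at hk
        omega
      · simp
  map_add' F G := by ext; simp [Finset.sum_add_distrib]
  map_mul' F G := by
    ext n
    simp only [coeff_mk, coeff_mul, map_sum, Finset.sum_mul_sum, Finset.sum_sigma']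
    refine Finset.sum_nbij'
      (fun a => ⟨(a.2.2.1 + a.2.1.1, a.2.2.2 + a.2.1.2), (a.2.2.1, a.2.1.1), (a.2.2.2, a.2.1.2)⟩)
      (fun a => ⟨(a.2.1.1 + a.2.2.1, a.2.1.2 + a.2.2.2), (a.2.1.2, a.2.2.2), (a.2.1.1, a.2.2.1)⟩)
      ?_ ?_ ?_ ?_ ?_
    · rintro ⟨⟨i, j⟩, ⟨j₁, j₂⟩, ⟨i₁, i₂⟩⟩ h
      simp only [Finset.mem_sigma, Finset.HasAntidiagonal.mem_antidiagonal] at h ⊢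
      obtain ⟨h, rfl, rfl⟩ := h
      exact ⟨by omega, by simp⟩
    · rintro ⟨⟨i, j⟩, ⟨j₁, j₂⟩, ⟨i₁, i₂⟩⟩ h
      simp only [Finset.mem_sigma, Finset.HasAntidiagonal.mem_antidiagonal] at h ⊢
      obtain ⟨h, rfl, rfl⟩ := h
      exact ⟨by omega, by simp⟩
    · rintro ⟨⟨i, j⟩, ⟨j₁, j₂⟩, ⟨i₁, i₂⟩⟩ h
      simp only [Finset.mem_sigma, Finset.HasAntidiagonal.mem_antidiagonal] at h
      obtain ⟨h, rfl, rfl⟩ := h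
      rfl
    · rintro ⟨⟨i, j⟩, ⟨j₁, j₂⟩, ⟨i₁, i₂⟩⟩ h
      simp only [Finset.mem_sigma, Finset.HasAntidiagonal.mem_antidiagonal] at h
      obtain ⟨h, rfl, rfl⟩ := h
      rfl
    · intro a _
      rfl

theorem diagonalHom_C (r : ℚ⟦X⟧) : diagonalHom (C r) = r := by
  ext n
  simp only [diagonalHom, RingHom.coe_mk, MonoidHom.coe_mk, OneHom.coe_mk, coeff_mk]
  rw [Finset.sum_eq_single (n, 0)]
  · simp
  · rintro ⟨a, b⟩ h hne
    rw [Finset.HasAntidiagonal.mem_antidiagonal] at h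
    have : b ≠ 0 := by rintro rfl; simp at h; simp [h] at hne
    simp [coeff_C, this]
  · simp

theorem diagonalHom_map_C (r : ℚ⟦X⟧) : diagonalHom (PowerSeries.map C r) = r := by
  ext n
  simp only [diagonalHom, RingHom.coe_mk, MonoidHom.coe_mk, OneHom.coe_mk, coeff_mk]
  rw [Finset.sum_eq_single (0, n)]
  · simp
  · rintro ⟨a, b⟩ h hne
    rw [Finset.HasAntidiagonal.mem_antidiagonal] at h
    have : a ≠ 0 := by rintro rfl; simp at h; simp [h] at hne
    simp [coeff_C, this]
  · simp

theorem constantCoeff_diagonalHom (F : ℚ⟦X⟧⟦X⟧) :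
    constantCoeff (diagonalHom F) = constantCoeff (constantCoeff F) := by
  rw [← coeff_zero_eq_constantCoeff_apply]
  simp [diagonalHom]

/-- The ring homomorphism `ℚ[y]⟦t⟧ → ℚ⟦t⟧` substituting the power series `Y` for `y`. -/
noncomputable def substHom (Y : ℚ⟦X⟧) : (Polynomial ℚ)⟦X⟧ →+* ℚ⟦X⟧ :=
  diagonalHom.comp (PowerSeries.map (Polynomial.eval₂RingHom C Y))

/-- The inclusion `ℚ⟦t⟧ → ℚ[y]⟦t⟧`. -/
noncomputable abbrev constHom : ℚ⟦X⟧ →+* (Polynomial ℚ)⟦X⟧ := PowerSeries.map Polynomial.C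

theorem substHom_constHom (Y r : ℚ⟦X⟧) : substHom Y (constHom r) = r := by
  conv_rhs => rw [← diagonalHom_map_C r]
  simp only [substHom, RingHom.comp_apply]
  congr 1
  ext n : 1
  simp

theorem substHom_C_X (Y : ℚ⟦X⟧) : substHom Y (C Polynomial.X) = Y := by
  simp [substHom, diagonalHom_C]

theorem constantCoeff_substHom (Y : ℚ⟦X⟧) (f : (Polynomial ℚ)⟦X⟧) :
    constantCoeff (substHom Y f) = (constantCoeff f).eval (constantCoeff Y) := by
  simp only [substHom, RingHom.comp_apply, constantCoeff_diagonalHom]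
  rw [← coeff_zero_eq_constantCoeff_apply (PowerSeries.map _ f), coeff_map,
    coeff_zero_eq_constantCoeff_apply, Polynomial.coe_eval₂RingHom, Polynomial.hom_eval₂]
  simp [Polynomial.eval₂_eq_eval_map]

/-- The derivative with respect to `y` on `ℚ[y]⟦t⟧`. -/
noncomputable def coeffDerivation : Derivation ℚ (Polynomial ℚ)⟦X⟧ (Polynomial ℚ)⟦X⟧ :=
  Derivation.mk'
    { toFun f := PowerSeries.mk fun n => Polynomial.derivative (coeff n f)
      map_add' f g := by ext1 n; simp
      map_smul' r f := by ext1 n; simp }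
    fun f g => by
      ext1 n
      simp only [LinearMap.coe_mk, AddHom.coe_mk, coeff_mk, coeff_mul, Polynomial.derivative_sum,
        Polynomial.derivative_mul, smul_eq_mul, map_add, Finset.sum_add_distrib]
      rw [add_comm]
      congr 1
      rw [← Finset.Nat.sum_antidiagonal_swap]
      exact Finset.sum_congr rfl fun k _ => mul_comm _ _

theorem coeffDerivation_constHom (r : ℚ⟦X⟧) : coeffDerivation (constHom r) = 0 := by
  ext1 n
  simp [coeffDerivation]

theorem coeffDerivation_C (q : Polynomial ℚ) :
    coeffDerivation (C q) = C (Polynomial.derivative q) := by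
  ext1 n
  simp [coeffDerivation, coeff_C]
  split_ifs <;> simp

/-- The equation obtained from the cubic equation `h` and its derivative in `y` by eliminating `b`.
The first term vanishes at `y = 1` and at the roots of `y ^ 2 = X ^ 2 * (1 + y) ^ 4`. -/
theorem critical_identity (N₁ : (Polynomial ℚ)⟦X⟧) (s b c : ℚ⟦X⟧)
    (h : let y := C Polynomial.X
      (y ^ 2 + X ^ 2 * (1 + y) ^ 4) * N₁ + (y * N₁) ^ 3 - constHom s * (1 + y) * (y * N₁) ^ 2 +
        constHom b * X * (1 + y) ^ 2 * (y * N₁) = constHom c * X ^ 2 * (1 + y) ^ 3) :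
    let y := C Polynomial.X
    (1 - y) * (y ^ 2 - X ^ 2 * (1 + y) ^ 4) * N₁ ^ 2 +
      ((1 + y) * coeffDerivation (y * N₁) - y * N₁) *
        (2 * (y * N₁) ^ 3 - constHom s * (1 + y) * (y * N₁) ^ 2 +
          constHom c * X ^ 2 * (1 + y) ^ 3) = 0 := by
  have hd := congrArg coeffDerivation h
  have dX : coeffDerivation X = 0 := by simpa using coeffDerivation_constHom X
  have dy : coeffDerivation (C Polynomial.X) = 1 := by simp [coeffDerivation_C]
  simp only [Derivation.leibniz, Derivation.leibniz_pow, map_add, map_sub, dX, dy,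
    coeffDerivation_constHom, Derivation.map_one_eq_zero, smul_eq_mul, nsmul_eq_mul] at h hd ⊢
  generalize (C Polynomial.X : (Polynomial ℚ)⟦X⟧) = y at *
  generalize coeffDerivation N₁ = N' at *
  push_cast at *
  linear_combination ((1 + y) * y * N₁) * hd - (2 * y * N₁ + (1 + y) * (N₁ + y * N')) * h
theorem ofNat_ne_zero_powerSeries (n : ℕ) [n.AtLeastTwo] : (OfNat.ofNat n : ℚ⟦X⟧) ≠ 0 := fun h => by
  have := congrArg constantCoeff h
  rw [map_ofNat, map_zero] at this
  exact OfNat.ofNat_ne_zero n this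

/-- The critical equations at the two roots of `y = X (1 + y) ^ 2` and `y = -X (1 + y) ^ 2`, and at
`y = 1`, determine `s` in terms of a single algebraic series `d`. -/
theorem exists_param_of_critical {s b c m₁ m₂ μ : ℚ⟦X⟧}
    (hm₁ : constantCoeff m₁ = 1) (hm₂ : constantCoeff m₂ = -1) (hμ : constantCoeff μ = 1)
    (h₁ : 2 * X * m₁ ^ 3 - s * m₁ ^ 2 + c = 0) (h₂ : 2 * X * m₂ ^ 3 - s * m₂ ^ 2 + c = 0)
    (h₃ : μ ^ 3 - s * μ ^ 2 + 4 * X ^ 2 * c = 0)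
    (v₁ : 2 = -3 * X * m₁ ^ 2 + 2 * s * m₁ - b) (v₂ : -2 = -3 * X * m₂ ^ 2 + 2 * s * m₂ - b)
    (v₃ : 16 * X ^ 2 + 1 = -3 * μ ^ 2 + 4 * s * μ - 4 * X * b) :
    ∃ d : ℚ⟦X⟧, constantCoeff d = 1 ∧ s * d = 1 + 3 * X ^ 2 * d ^ 4 ∧
      d ^ 2 * (1 + 16 * X ^ 2) = 1 + 18 * X ^ 2 * d ^ 4 - 27 * X ^ 4 * d ^ 8 := by
  have two : (2 : ℚ⟦X⟧) ≠ 0 := ofNat_ne_zero_powerSeries 2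
  have hX : (X : ℚ⟦X⟧) ≠ 0 := X_ne_zero
  have half : (2 : ℚ⟦X⟧) * C (1 / 2) = 1 := by
    rw [show (2 : ℚ⟦X⟧) = C 2 from (map_ofNat C 2).symm, ← map_mul]; norm_num
  obtain ⟨d, hd⟩ : ∃ d : ℚ⟦X⟧, 2 * d = m₁ - m₂ :=
    ⟨C (1 / 2) * (m₁ - m₂), by rw [← mul_assoc, half, one_mul]⟩
  obtain ⟨h, hh⟩ : ∃ h : ℚ⟦X⟧, 2 * h = m₁ + m₂ :=
    ⟨C (1 / 2) * (m₁ + m₂), by rw [← mul_assoc, half, one_mul]⟩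
  have e₁ : m₁ = h + d := mul_left_cancel₀ two (by linear_combination -hd - hh)
  have e₂ : m₂ = h - d := mul_left_cancel₀ two (by linear_combination hd - hh)
  have cd : constantCoeff d = 1 := by
    have := congrArg constantCoeff hd
    simp [hm₁, hm₂, map_ofNat] at this
    linarith
  have d0 : d ≠ 0 := by rintro rfl; simp at cd
  have n₁ : 2 * X * m₁ - μ ≠ 0 := fun h => by simpa [hμ] using congrArg constantCoeff h
  have n₂ : 2 * X * m₂ - μ ≠ 0 := fun h => by simpa [hμ] using congrArg constantCoeff h
  have q₁₂ : 2 * X * (m₁ ^ 2 + m₁ * m₂ + m₂ ^ 2) = s * (m₁ + m₂) :=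
    mul_left_cancel₀ (mul_ne_zero two d0) (by rw [hd]; linear_combination h₁ - h₂)
  have q₁₃ : (2 * X * m₁) ^ 2 + (2 * X * m₁) * μ + μ ^ 2 = s * (2 * X * m₁ + μ) :=
    mul_left_cancel₀ n₁ (by linear_combination 4 * X ^ 2 * h₁ - h₃)
  have sum : 2 * X * m₁ + 2 * X * m₂ + μ = s :=
    mul_left_cancel₀ n₂ (by linear_combination 2 * X * q₁₂ - q₁₃)
  have one : d * (s - 3 * X * h) = 1 :=
    mul_left_cancel₀ (mul_ne_zero two two) (by subst e₁ e₂; linear_combination v₂ - v₁)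
  have hs : h * s = X * (3 * h ^ 2 + d ^ 2) :=
    mul_left_cancel₀ two (by subst e₁ e₂; linear_combination -q₁₂)
  have h_eq : h = X * d ^ 3 := by linear_combination d * hs - h * one
  have sd : s * d = 1 + 3 * X ^ 2 * d ^ 4 := by rw [h_eq] at one; linear_combination one
  have hb : b = 2 * s * h - 3 * X * (h ^ 2 + d ^ 2) :=
    mul_left_cancel₀ two (by subst e₁ e₂; linear_combination v₁ + v₂)
  refine ⟨d, cd, sd, ?_⟩
  have hμ' : μ = s - 4 * X * h := by subst e₁ e₂; linear_combination sum
  rw [hb, hμ', h_eq] at v₃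
  linear_combination d ^ 2 * v₃ + (s * d + 1 + 3 * X ^ 2 * d ^ 4) * sd

/-- A rational uniformization of the algebraic equations for `s` and `d`. -/
theorem exists_uniformization {s d : ℚ⟦X⟧} (cd : constantCoeff d = 1)
    (sd : s * d = 1 + 3 * X ^ 2 * d ^ 4)
    (hd : d ^ 2 * (1 + 16 * X ^ 2) = 1 + 18 * X ^ 2 * d ^ 4 - 27 * X ^ 4 * d ^ 8) :
    ∃ p g : ℚ⟦X⟧, constantCoeff p = 1 ∧ 3 * (2 - p) ^ 3 * (2 + p) * g ^ 2 = 1 ∧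
      X ^ 2 = 3 * (1 - p) * g ^ 2 ∧ s = (8 - 4 * p - p ^ 2) * g := by
  have hu : constantCoeff (4 - 3 * d ^ 2) ≠ 0 := by
    simp [cd, map_ofNat]; norm_num
  have hinv := PowerSeries.mul_inv_cancel _ hu
  set v := (4 - 3 * d ^ 2)⁻¹
  have hu0 : (4 - 3 * d ^ 2) ≠ 0 := fun h => hu (by simp [h])
  set p := (9 * d ^ 2 - 8 - 27 * X ^ 2 * d ^ 6) * v with hp
  have hp1 : p * (4 - 3 * d ^ 2) = 9 * d ^ 2 - 8 - 27 * X ^ 2 * d ^ 6 := by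
    rw [hp]; linear_combination (9 * d ^ 2 - 8 - 27 * X ^ 2 * d ^ 6) * hinv
  have hp2 : p ^ 2 = 4 - 3 * d ^ 2 := by
    refine mul_left_cancel₀ (pow_ne_zero 2 hu0) ?_
    have : (p * (4 - 3 * d ^ 2)) ^ 2 = (9 * d ^ 2 - 8 - 27 * X ^ 2 * d ^ 6) ^ 2 := by rw [hp1]
    linear_combination this + 27 * d ^ 4 * hd
  have cp : constantCoeff p = 1 := by
    have := congrArg constantCoeff hp1
    simp [cd, map_ofNat] at this
    linarith
  have hw : constantCoeff (3 * (2 - p) * d) ≠ 0 := by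
    simp [cd, cp, map_ofNat]; norm_num
  have hg := PowerSeries.mul_inv_cancel _ hw
  set g := (3 * (2 - p) * d)⁻¹
  have d0 : d ≠ 0 := by rintro rfl; simp at cd
  have hg2 : 3 * (2 - p) ^ 3 * (2 + p) * g ^ 2 = 1 := by
    linear_combination (-3 * (2 - p) ^ 2 * g ^ 2) * hp2 + (3 * (2 - p) * d * g + 1) * hg
  clear_value p g
  have hX : 27 * X ^ 2 * d ^ 6 = (1 - p) * (2 + p) ^ 2 := by
    linear_combination hp1 + (3 + p) * hp2
  refine ⟨p, g, cp, hg2, ?_, ?_⟩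
  · have hk : (3 * (2 - p) * d * g) ^ 6 = 1 := by rw [hg, one_pow]
    linear_combination -X ^ 2 * hk + 27 * (2 - p) ^ 6 * g ^ 6 * hX +
      3 * (1 - p) * g ^ 2 * (3 * (2 - p) ^ 3 * (2 + p) * g ^ 2 + 1) * hg2
  · have h9 : 9 * X ^ 2 * d ^ 4 * (2 - p) = (1 - p) * (2 + p) := by
      refine mul_left_cancel₀ (mul_ne_zero (ofNat_ne_zero_powerSeries 3) (pow_ne_zero 2 d0)) ?_
      linear_combination (2 - p) * hX - (1 - p) * (2 + p) * hp2
    linear_combination -s * hg + 3 * (2 - p) * g * sd + g * h9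

/-- The second-order linear differential equation satisfied by `s`, for a derivation `D` acting as
`X d/dX`. -/
theorem ode {s p g : ℚ⟦X⟧} (cp : constantCoeff p = 1)
    (hg : 3 * (2 - p) ^ 3 * (2 + p) * g ^ 2 = 1)
    (hX : X ^ 2 = 3 * (1 - p) * g ^ 2) (hs : s = (8 - 4 * p - p ^ 2) * g)
    (D : Derivation ℚ ℚ⟦X⟧ ℚ⟦X⟧)
    (hD : D X = X) :
    3 * D (D s) - 2 * D s = 16 * X ^ 2 * (3 * D (D s) - 4 * D s + s) := by
  have p0 : p ≠ 0 := by rintro rfl; simp at cp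
  have g0 : g ≠ 0 := by rintro rfl; simp at hg
  have D2 (a : ℚ⟦X⟧) : D (a ^ 2) = 2 * a * D a := by simp [D.leibniz_pow]; ring
  have D3 (a : ℚ⟦X⟧) : D (a ^ 3) = 3 * a ^ 2 * D a := by simp [D.leibniz_pow]; ring
  have Dn (k : ℕ) [k.AtLeastTwo] : D (OfNat.ofNat k : ℚ⟦X⟧) = 0 := D.map_natCast k
  have Dg := congrArg D hg
  have Ds := congrArg D hs
  simp only [D.leibniz, D2, D3, map_add, map_sub, Dn, D.map_one_eq_zero, smul_eq_mul] at Dg Ds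
  have hw : X ^ 2 * ((2 - p) ^ 3 * (2 + p)) = 1 - p := by
    linear_combination (2 - p) ^ 3 * (2 + p) * hX + (1 - p) * hg
  have Dw := congrArg D hw
  simp only [D.leibniz, D2, D3, map_add, map_sub, Dn, D.map_one_eq_zero, smul_eq_mul, hD] at Dw
  have Dp : 3 * p ^ 2 * D p = -2 * (1 - p) * (4 - p ^ 2) := by
    linear_combination (4 - p ^ 2) * Dw - (2 * (4 - p ^ 2) - 4 * (1 + p) * D p) * hw
  have Dg' : 3 * p ^ 2 * D g = -4 * (1 - p ^ 2) * g := by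
    refine mul_left_cancel₀ (ofNat_ne_zero_powerSeries 2) ?_
    linear_combination 3 * p ^ 2 * g * Dg - 6 * p ^ 2 * D g * hg +
      12 * g ^ 3 * (2 - p) ^ 2 * (1 + p) * Dp - 8 * g * (1 - p ^ 2) * hg
  have Ds' : D s = 4 * (1 - p) * g := by
    refine mul_left_cancel₀ (mul_ne_zero (ofNat_ne_zero_powerSeries 3) (pow_ne_zero 2 p0)) ?_
    linear_combination 3 * p ^ 2 * Ds + (8 - 4 * p - p ^ 2) * Dg' - (4 + 2 * p) * g * Dp
  have DDs : 3 * p ^ 2 * D (D s) = 8 * (1 - p) * (2 + p ^ 2) * g := by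
    rw [Ds']
    simp only [D.leibniz, map_sub, Dn, D.map_one_eq_zero, smul_eq_mul]
    linear_combination 4 * (1 - p) * Dg' - 4 * g * Dp
  refine mul_left_cancel₀ (pow_ne_zero 2 p0) ?_
  linear_combination (1 - 16 * X ^ 2) * DDs + p ^ 2 * (64 * X ^ 2 - 2) * Ds' -
    16 * X ^ 2 * p ^ 2 * hs - 16 * g * hw

theorem exists_fixedPoint (ε : ℚ⟦X⟧) (hε : ε = 1 ∨ ε = -1) :
    ∃ Y : ℚ⟦X⟧, Y = ε * X * (1 + Y) ^ 2 := by
  have h : ∃ Y : ℚ⟦X⟧, Y = X * (1 + Y) ^ 2 := by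
    refine ⟨PowerSeries.map (Nat.castRingHom ℚ) catalanSeries - 1, ?_⟩
    have := congrArg (PowerSeries.map (Nat.castRingHom ℚ)) catalanSeries_sq_mul_X_add_one
    simp only [map_add, map_mul, map_pow, map_X, map_one] at this
    linear_combination -this
  obtain ⟨Y, hY⟩ := h
  rcases hε with rfl | rfl
  · exact ⟨Y, by rw [one_mul]; exact hY⟩
  · refine ⟨evalNegHom Y, ?_⟩
    have := congrArg evalNegHom hY
    simp only [map_add, map_mul, map_pow, evalNegHom_X, map_one] at this
    linear_combination this

theorem exists_param_of_cubic (N₁ : (Polynomial ℚ)⟦X⟧) (s b c : ℚ⟦X⟧) (hN : constantCoeff N₁ = 1)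
    (h : let y := C Polynomial.X
      (y ^ 2 + X ^ 2 * (1 + y) ^ 4) * N₁ + (y * N₁) ^ 3 - constHom s * (1 + y) * (y * N₁) ^ 2 +
        constHom b * X * (1 + y) ^ 2 * (y * N₁) = constHom c * X ^ 2 * (1 + y) ^ 3) :
    ∃ d : ℚ⟦X⟧, constantCoeff d = 1 ∧ s * d = 1 + 3 * X ^ 2 * d ^ 4 ∧
      d ^ 2 * (1 + 16 * X ^ 2) = 1 + 18 * X ^ 2 * d ^ 4 - 27 * X ^ 4 * d ^ 8 := by
  have subst_X (Y : ℚ⟦X⟧) : substHom Y X = X := by simpa using substHom_constHom Y X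
  have value (Y : ℚ⟦X⟧) : (Y ^ 2 + X ^ 2 * (1 + Y) ^ 4) * substHom Y N₁ + (Y * substHom Y N₁) ^ 3 -
      s * (1 + Y) * (Y * substHom Y N₁) ^ 2 + b * X * (1 + Y) ^ 2 * (Y * substHom Y N₁) =
        c * X ^ 2 * (1 + Y) ^ 3 := by
    simpa only [map_add, map_sub, map_mul, map_pow, map_one, subst_X, substHom_C_X,
      substHom_constHom] using congrArg (substHom Y) h
  have critical (Y : ℚ⟦X⟧) (hY : (1 - Y) * (Y ^ 2 - X ^ 2 * (1 + Y) ^ 4) = 0) :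
      2 * (Y * substHom Y N₁) ^ 3 - s * (1 + Y) * (Y * substHom Y N₁) ^ 2 +
        c * X ^ 2 * (1 + Y) ^ 3 = 0 := by
    have := congrArg (substHom Y) (critical_identity N₁ s b c h)
    simp only [map_add, map_sub, map_mul, map_pow, map_one, map_ofNat, subst_X, substHom_C_X,
      substHom_constHom, map_zero, hY, zero_mul, zero_add] at this
    refine (mul_eq_zero.1 this).resolve_left fun h0 => ?_
    have hd : constantCoeff (coeffDerivation (C Polynomial.X * N₁)) = 1 := by
      rw [← coeff_zero_eq_constantCoeff_apply]
      simp [coeffDerivation, hN]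
    have := congrArg constantCoeff h0
    simp only [map_sub, map_mul, map_add, constantCoeff_substHom, hd, hN] at this
    simp at this
  have c_subst (Y : ℚ⟦X⟧) : constantCoeff (substHom Y N₁) = 1 := by
    simp [constantCoeff_substHom, hN]
  have hX : (X : ℚ⟦X⟧) ≠ 0 := X_ne_zero
  have branch (ε : ℚ⟦X⟧) (hε : ε = 1 ∨ ε = -1) : ∃ m : ℚ⟦X⟧, constantCoeff m = constantCoeff ε ∧
      2 * X * m ^ 3 - s * m ^ 2 + c = 0 ∧ 2 * ε = -3 * X * m ^ 2 + 2 * s * m - b := by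
    obtain ⟨Y, hY⟩ := exists_fixedPoint ε hε
    have hε2 : ε ^ 2 = 1 := by rcases hε with rfl | rfl <;> norm_num
    have cY : constantCoeff Y = 0 := by rw [hY]; simp
    have e0 : 1 + Y ≠ 0 := fun h => by simpa [cY] using congrArg constantCoeff h
    obtain ⟨m, hm⟩ : ∃ m, m = ε * (1 + Y) * substHom Y N₁ := ⟨_, rfl⟩
    have cm : constantCoeff m = constantCoeff ε := by simp [hm, cY, c_subst]
    have m0 : m ≠ 0 := fun h => by
      rw [h, map_zero] at cm
      rcases hε with rfl | rfl <;> simp at cm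
    have hYm : Y * substHom Y N₁ = X * (1 + Y) * m := by
      rw [hm]; linear_combination substHom Y N₁ * hY
    have hYY : Y ^ 2 = X ^ 2 * (1 + Y) ^ 4 := by
      linear_combination (Y + ε * X * (1 + Y) ^ 2) * hY + X ^ 2 * (1 + Y) ^ 4 * hε2
    have unit : X ^ 2 * (1 + Y) ^ 3 ≠ 0 := mul_ne_zero (pow_ne_zero 2 hX) (pow_ne_zero 3 e0)
    have crit : 2 * X * m ^ 3 - s * m ^ 2 + c = 0 := by
      have := critical Y (by rw [← hYY]; ring)
      rw [hYm] at this
      exact mul_left_cancel₀ unit (by linear_combination this)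
    refine ⟨m, cm, crit, mul_left_cancel₀ (mul_ne_zero unit m0) ?_⟩
    have hv := value Y
    have hεm : ε * m = (1 + Y) * substHom Y N₁ := by
      rw [hm]; linear_combination (1 + Y) * substHom Y N₁ * hε2
    rw [hYm, hYY] at hv
    linear_combination hv + X ^ 2 * (1 + Y) ^ 3 * crit + 2 * X ^ 2 * (1 + Y) ^ 3 * hεm
  obtain ⟨m₁, hm₁, h₁, v₁⟩ := branch 1 (.inl rfl)
  obtain ⟨m₂, hm₂, h₂, v₂⟩ := branch (-1) (.inr rfl)
  have h₃ := critical 1 (by ring)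
  have v₃ := value 1
  have hμ := c_subst 1
  refine exists_param_of_critical (c := c) (b := b) (by simpa using hm₁) (by simpa using hm₂)
    hμ h₁ h₂
    (mul_left_cancel₀ (ofNat_ne_zero_powerSeries 2) ?_) (by linear_combination v₁)
    (by linear_combination v₂)
    (mul_left_cancel₀ (a := substHom 1 N₁) (fun h => by simp [h] at hμ) ?_)
  · linear_combination h₃
  · linear_combination v₃ + h₃

/-- The inclusion `ℚ[x]⟦t⟧ → ℚ[x][y]⟦t⟧`. -/
noncomputable abbrev inclX : (Polynomial ℚ)⟦X⟧ →+* (Polynomial (Polynomial ℚ))⟦X⟧ :=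
  PowerSeries.map Polynomial.C

/-- The inclusion `ℚ[y]⟦t⟧ → ℚ[x][y]⟦t⟧`. -/
noncomputable abbrev inclY : (Polynomial ℚ)⟦X⟧ →+* (Polynomial (Polynomial ℚ))⟦X⟧ :=
  PowerSeries.map (Polynomial.mapRingHom Polynomial.C)

/-- Setting `y = 0`. -/
noncomputable abbrev zeroY : (Polynomial (Polynomial ℚ))⟦X⟧ →+* (Polynomial ℚ)⟦X⟧ :=
  PowerSeries.map (Polynomial.evalRingHom 0)

/-- Setting `x = 0`. -/
noncomputable abbrev zeroX : (Polynomial (Polynomial ℚ))⟦X⟧ →+* (Polynomial ℚ)⟦X⟧ :=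
  PowerSeries.map (Polynomial.mapRingHom (Polynomial.evalRingHom 0))

/-- Setting the variable of the coefficients to `0`. -/
noncomputable abbrev constCoeffHom : (Polynomial ℚ)⟦X⟧ →+* ℚ⟦X⟧ :=
  PowerSeries.map (Polynomial.evalRingHom 0)

/-- The variable `x` of `ℚ[x][y]⟦t⟧`. -/
noncomputable abbrev varX : (Polynomial (Polynomial ℚ))⟦X⟧ := C (Polynomial.C Polynomial.X)

/-- The variable `y` of `ℚ[x][y]⟦t⟧`. -/
noncomputable abbrev varY : (Polynomial (Polynomial ℚ))⟦X⟧ := C Polynomial.X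

/-- The kernel polynomial of Gessel walks. -/
noncomputable def kernel : (Polynomial (Polynomial ℚ))⟦X⟧ :=
  varX * varY - X * (1 + varY) * (1 + varX ^ 2 * varY)

theorem zeroX_inclY (f : (Polynomial ℚ)⟦X⟧) : zeroX (inclY f) = f := by
  ext n : 1
  have : (Polynomial.evalRingHom 0).comp Polynomial.C = RingHom.id ℚ := RingHom.ext fun q => by simp
  simp [Polynomial.map_map, this]

theorem zeroX_inclX (f : (Polynomial ℚ)⟦X⟧) : zeroX (inclX f) = constHom (constCoeffHom f) := by
  ext n : 1
  simp

theorem inclX_constHom (f : ℚ⟦X⟧) : inclX (constHom f) = inclY (constHom f) := by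
  ext n : 1
  simp

theorem varY_dvd_of_zeroY {f : (Polynomial (Polynomial ℚ))⟦X⟧} (h : zeroY f = 0) : varY ∣ f := by
  have (n : ℕ) : Polynomial.X ∣ coeff n f := by
    rw [Polynomial.X_dvd_iff, Polynomial.coeff_zero_eq_eval_zero]
    simpa using congrArg (coeff n) h
  choose g hg using this
  exact ⟨PowerSeries.mk g, by ext1 n; simp [hg]⟩

theorem varX_dvd_of_zeroX {f : (Polynomial (Polynomial ℚ))⟦X⟧} (h : zeroX f = 0) : varX ∣ f := by
  have (n : ℕ) : Polynomial.C Polynomial.X ∣ coeff n f := by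
    rw [Polynomial.C_dvd_iff_dvd_coeff]
    intro i
    rw [Polynomial.X_dvd_iff, Polynomial.coeff_zero_eq_eval_zero]
    have := congrArg (fun g => (coeff n g).coeff i) h
    simpa using this
  choose g hg using this
  exact ⟨PowerSeries.mk g, by ext1 n; simp [hg]⟩

theorem zeroX_kernel : zeroX kernel = -X * (1 + C Polynomial.X) := by
  simp [kernel]

theorem zeroY_kernel : zeroY kernel = -X := by
  simp [kernel]

theorem one_add_C_X_ne_zero : (1 + C Polynomial.X : (Polynomial ℚ)⟦X⟧) ≠ 0 := fun h => by
  have := congrArg (fun f => (constantCoeff f).eval 0) h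
  simp at this

theorem varX_ne_zero : varX ≠ 0 :=
  (map_ne_zero_iff _ C_injective).2 (Polynomial.C_ne_zero.2 Polynomial.X_ne_zero)

theorem varY_ne_zero : varY ≠ 0 :=
  (map_ne_zero_iff _ C_injective).2 Polynomial.X_ne_zero

theorem kernel_dvd_of_varX_mul {f : (Polynomial (Polynomial ℚ))⟦X⟧} (h : kernel ∣ varX * f) :
    kernel ∣ f := by
  obtain ⟨G, hG⟩ := h
  have h0 := congrArg zeroX hG
  rw [map_mul, map_mul, zeroX_kernel, show zeroX varX = 0 by simp, zero_mul] at h0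
  obtain ⟨G, rfl⟩ := varX_dvd_of_zeroX ((mul_eq_zero.1 h0.symm).resolve_left
    (mul_ne_zero (neg_ne_zero.2 X_ne_zero) one_add_C_X_ne_zero))
  have hx : varX ≠ 0 := varX_ne_zero
  exact ⟨G, mul_left_cancel₀ hx (by rw [hG]; ring)⟩

theorem kernel_dvd_of_varY_mul {f : (Polynomial (Polynomial ℚ))⟦X⟧} (h : kernel ∣ varY * f) :
    kernel ∣ f := by
  obtain ⟨G, hG⟩ := h
  have h0 := congrArg zeroY hG
  rw [map_mul, map_mul, zeroY_kernel, show zeroY varY = 0 by simp, zero_mul] at h0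
  obtain ⟨G, rfl⟩ := varY_dvd_of_zeroY ((mul_eq_zero.1 h0.symm).resolve_left
    (neg_ne_zero.2 X_ne_zero))
  have hx : varY ≠ 0 := varY_ne_zero
  exact ⟨G, mul_left_cancel₀ hx (by rw [hG]; ring)⟩

/-- Invariant lemma: a pair of series in `x` and in `y` which agree, up to a factor `(1 + y) ^ k`,
modulo the kernel is a pair of equal series. -/
theorem eq_zero_of_kernel_dvd (f g : (Polynomial ℚ)⟦X⟧) (k : ℕ)
    (h : kernel ∣ inclY g - (1 + varY) ^ k * inclX f) : inclY g = (1 + varY) ^ k * inclX f := by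
  obtain ⟨G, hG⟩ := h
  suffices G = 0 by rw [this, mul_zero] at hG; exact sub_eq_zero.1 hG
  ext1 n
  induction n using Nat.strong_induction_on with
  | _ n ih =>
  have hn : (Polynomial.C Polynomial.X * Polynomial.X) * coeff n G =
      (coeff n g).map Polynomial.C - (1 + Polynomial.X) ^ k * Polynomial.C (coeff n f) := by
    have h1 : coeff n (X * (C ((1 + Polynomial.X) *
        (1 + Polynomial.C Polynomial.X ^ 2 * Polynomial.X)) * G)) = 0 := by
      cases n with
      | zero => simp
      | succ n => rw [coeff_succ_X_mul, coeff_C_mul, ih n (Nat.lt_succ_self n)]; simp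
    have hk : kernel * G = C (Polynomial.C Polynomial.X * Polynomial.X) * G -
        X * (C ((1 + Polynomial.X) * (1 + Polynomial.C Polynomial.X ^ 2 * Polynomial.X)) * G) := by
      simp [kernel]; ring
    have he : ((1 : (Polynomial (Polynomial ℚ))⟦X⟧) + varY) ^ k = C ((1 + Polynomial.X) ^ k) := by
      simp
    have h2 := congrArg (coeff n) hG
    rw [hk, map_sub (coeff n) (C _ * G), h1, coeff_C_mul, sub_zero, map_sub, he, coeff_C_mul] at h2
    simpa using h2.symm
  have hx := congrArg
    (Polynomial.mapRingHom (Polynomial.C.comp (Polynomial.evalRingHom (0 : ℚ)))) hn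
  have hy := congrArg (fun p => Polynomial.C (p.eval 0)) hn
  have hid : (Polynomial.C.comp (Polynomial.evalRingHom 0)).comp Polynomial.C =
    (Polynomial.C : ℚ →+* Polynomial ℚ) := RingHom.ext fun q => by simp
  simp [Polynomial.map_map, hid] at hx hy
  have hf : coeff n f = Polynomial.C ((coeff n g).eval 0) :=
    (Polynomial.C_injective (sub_eq_zero.1 hy.symm)).symm
  rw [hf, Polynomial.eval_C, ← hf] at hx
  rw [← hx] at hn
  simpa using hn

theorem gesselCount_eq_zero_of_lt : ∀ n i j : ℕ, n < i ∨ n < j → gesselCount n i j = 0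
  | 0, i, j, h => by simp only [gesselCount]; rw [if_neg (by omega)]
  | n + 1, i, j, h => by
    simp only [gesselCount]
    rw [gesselCount_eq_zero_of_lt n (i + 1) j (by omega),
      gesselCount_eq_zero_of_lt n (i + 1) (j + 1) (by omega),
      gesselCount_eq_zero_of_lt n (i - 1) j (by omega),
      gesselCount_eq_zero_of_lt n (i - 1) (j - 1) (by omega)]
    simp

/-- The generating polynomial of Gessel walks with `n` steps; the inner variable `x` records the
abscissa, and the outer variable `y` the ordinate, of the endpoint. -/
noncomputable def walkPoly (n : ℕ) : Polynomial (Polynomial ℚ) :=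
  ∑ j ∈ Finset.range (n + 1), ∑ i ∈ Finset.range (n + 1),
    Polynomial.monomial j (Polynomial.monomial i (gesselCount n i j : ℚ))

theorem coeff_walkPoly (n i j : ℕ) :
    ((walkPoly n).coeff j).coeff i = (gesselCount n i j : ℚ) := by
  simp only [walkPoly, Polynomial.finsetSum_coeff, Polynomial.coeff_monomial]
  have h (b c : ℕ) : (if c = j then Polynomial.monomial b (gesselCount n b c : ℚ) else 0).coeff i =
      if b = i then (if c = j then (gesselCount n b c : ℚ) else 0) else 0 := by
    split_ifs with h1 h2 h2 <;> simp [Polynomial.coeff_monomial, h2]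
  simp only [h, Finset.sum_ite_eq', Finset.mem_range]
  split_ifs with h1
  · simp only [Finset.sum_ite_eq', Finset.mem_range]
    split_ifs with h2
    · rfl
    · rw [gesselCount_eq_zero_of_lt n i j (by omega), Nat.cast_zero]
  · rw [Finset.sum_const_zero, gesselCount_eq_zero_of_lt n i j (by omega), Nat.cast_zero]

theorem walkPoly_zero : walkPoly 0 = 1 := by
  simp [walkPoly, gesselCount]

theorem walkPoly_succ (n : ℕ) :
    Polynomial.C Polynomial.X * (Polynomial.X * walkPoly (n + 1)) +
        Polynomial.C ((walkPoly n).eval 0) +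
        (1 + Polynomial.X) * ((walkPoly n).map (Polynomial.evalRingHom 0)).map Polynomial.C =
      walkPoly n + Polynomial.X * walkPoly n +
        Polynomial.C Polynomial.X * (Polynomial.C Polynomial.X * (Polynomial.X * walkPoly n)) +
        Polynomial.C Polynomial.X * (Polynomial.C Polynomial.X *
          (Polynomial.X * (Polynomial.X * walkPoly n))) +
        Polynomial.C (Polynomial.C (((walkPoly n).eval 0).eval 0)) := by
  rw [add_mul, one_mul]
  ext j i
  rcases j with _ | _ | j <;> rcases i with _ | _ | i <;>
  simp [Polynomial.coeff_C, ← Polynomial.coeff_zero_eq_eval_zero, coeff_walkPoly, gesselCount] <;>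
  ring

/-- The generating function of Gessel walks. -/
noncomputable def walkSeries : (Polynomial (Polynomial ℚ))⟦X⟧ := PowerSeries.mk walkPoly

theorem kernel_mul_walkSeries :
    kernel * walkSeries = varX * varY - X * inclX (zeroY walkSeries) -
      X * (1 + varY) * inclY (zeroX walkSeries) +
      X * inclX (constHom (constCoeffHom (zeroY walkSeries))) := by
  have hk : kernel * walkSeries = C (Polynomial.C Polynomial.X * Polynomial.X) * walkSeries -
      X * (C ((1 + Polynomial.X) * (1 + Polynomial.C Polynomial.X ^ 2 * Polynomial.X)) *
        walkSeries) := by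
    simp [kernel]; ring
  have hr : varX * varY - X * inclX (zeroY walkSeries) -
      X * (1 + varY) * inclY (zeroX walkSeries) +
      X * inclX (constHom (constCoeffHom (zeroY walkSeries))) =
      C (Polynomial.C Polynomial.X * Polynomial.X) + X * (-inclX (zeroY walkSeries) -
        C (1 + Polynomial.X) * inclY (zeroX walkSeries) +
        inclX (constHom (constCoeffHom (zeroY walkSeries)))) := by
    simp; ring
  rw [hk, hr]
  ext1 n
  cases n with
  | zero => simp [walkSeries, walkPoly_zero]
  | succ n =>
    have := walkPoly_succ n
    rw [map_sub, map_add, coeff_succ_X_mul, coeff_succ_X_mul, coeff_C_mul, coeff_C_mul, map_add,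
      map_sub, map_neg, coeff_C_mul]
    simp only [walkSeries, coeff_map, coeff_mk, coeff_C, Nat.succ_ne_zero, if_false,
      Polynomial.coe_evalRingHom, Polynomial.coe_mapRingHom]
    linear_combination this

theorem constCoeffHom_zeroY_walkSeries :
    constCoeffHom (zeroY walkSeries) = PowerSeries.mk fun n => (gesselCount n 0 0 : ℚ) := by
  ext n
  simp [walkSeries, ← Polynomial.coeff_zero_eq_eval_zero, coeff_walkPoly]

theorem constCoeffHom_zeroX (f : (Polynomial (Polynomial ℚ))⟦X⟧) :
    constCoeffHom (zeroX f) = constCoeffHom (zeroY f) := by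
  ext n
  simp [← Polynomial.coeff_zero_eq_eval_zero]

theorem exists_eq_constHom_add (f : (Polynomial ℚ)⟦X⟧) :
    ∃ g, f = constHom (constCoeffHom f) + C Polynomial.X * g := by
  refine ⟨PowerSeries.mk fun n => (coeff n f).divX, ?_⟩
  ext1 n
  rw [map_add, coeff_C_mul, coeff_map, coeff_map, coeff_mk, Polynomial.coe_evalRingHom,
    ← Polynomial.coeff_zero_eq_eval_zero, add_comm, Polynomial.X_mul_divX_add]

/-- The coefficient of the quadratic term of the invariants. -/
def invariantS {R : Type*} [CommRing R] (t a₀ : R) : R := 1 + 2 * t ^ 2 * a₀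

/-- The coefficient of the linear term of the invariants. -/
def invariantB {R : Type*} [CommRing R] (t a₀ a₁ : R) : R :=
  t * a₀ - 2 * t - 2 * t ^ 2 * a₁ + t ^ 3 * a₀ ^ 2

/-- The invariant in `x`, as a function of the expansion `a₀ + a₁ x + a₂ x²` of the generating
function of walks ending on the first axis. -/
def invariantX {R : Type*} [CommRing R] (x t a₀ a₁ a₂ : R) : R :=
  let α := t * a₀
  let β := t * a₁
  let s := invariantS t a₀
  let b := invariantB t a₀ a₁
  let r := 1 + α * x + β * x ^ 2
  let p := r + t * x ^ 3 * a₂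
  (1 + 2 * t * α + β + t * (6 * α * β + α ^ 3) - s * (α ^ 2 + 2 * β) + b * α) +
    x * (-t + α + 2 * t * β + t * (3 * β ^ 2 + 3 * α ^ 2 * β) - 2 * s * α * β + b * β) +
    x ^ 2 * (-t * α + β + 3 * t * α * β ^ 2 - s * β ^ 2) +
    x ^ 3 * (-t * β + t * β ^ 3) +
    t * a₂ * (-t + x + 2 * t * x ^ 2 + x ^ 3 - t * x ^ 4 + t * (p ^ 2 + p * r + r ^ 2) -
      s * x * (p + r) + b * x ^ 2)

theorem pow_three_mul_invariantX {R : Type*} [CommRing R] (x t a₀ a₁ a₂ p : R)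
    (hp : p = 1 + t * x * (a₀ + x * (a₁ + x * a₂))) :
    x ^ 3 * invariantX x t a₀ a₁ a₂ = (-t + x + 2 * t * x ^ 2 + x ^ 3 - t * x ^ 4) * p +
      t * p ^ 3 - invariantS t a₀ * x * p ^ 2 + invariantB t a₀ a₁ * x ^ 2 * p := by
  subst hp
  simp only [invariantX, invariantS, invariantB]
  ring

/-- The invariant in `y`. -/
def invariantY {R : Type*} [CommRing R] (y t s b N : R) : R :=
  (y ^ 2 + t ^ 2 * (1 + y) ^ 4) * N + (y * N) ^ 3 - s * (1 + y) * (y * N) ^ 2 +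
    b * t * (1 + y) ^ 2 * (y * N)

theorem kernel_dvd_invariants {R : Type*} [CommRing R] {x y t κ Q a₀ a₁ a₂ b' : R}
    (hκ : κ = x * y - t * (1 + y) * (1 + x ^ 2 * y))
    (h : κ * Q = x * y - t * (a₀ + x * (a₁ + x * a₂)) - t * (1 + y) * (a₀ + y * b') + t * a₀) :
    κ ∣ y * (x * (x * (x * (invariantY y t (invariantS t a₀) (invariantB t a₀ a₁)
      (1 - t ^ 2 * (1 + y) ^ 2 * b' - t ^ 2 * (1 + y) * a₀) -
        (1 + y) ^ 3 * (t ^ 2 * invariantX x t a₀ a₁ a₂))))) := by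
  obtain ⟨p, hp⟩ : ∃ p, p = 1 + t * x * (a₀ + x * (a₁ + x * a₂)) := ⟨_, rfl⟩
  have hX := pow_three_mul_invariantX x t a₀ a₁ a₂ p hp
  obtain ⟨N, hN⟩ : ∃ N, N = 1 - t ^ 2 * (1 + y) ^ 2 * b' - t ^ 2 * (1 + y) * a₀ := ⟨_, rfl⟩
  have hZ : x * (y * N) - t * (1 + y) * p = κ * (1 + t * x * (1 + y) * Q) := by
    rw [hN, hp]
    linear_combination (-t * x * (1 + y)) * h - hκ
  rw [← hN]
  generalize invariantS t a₀ = s at *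
  generalize invariantB t a₀ a₁ = b at *
  generalize invariantX x t a₀ a₁ a₂ = f at *
  obtain ⟨K, hK⟩ : ∃ K, K = x ^ 2 * (y ^ 2 + t ^ 2 * (1 + y) ^ 4) +
    y * ((x * (y * N)) ^ 2 + (x * (y * N)) * (t * (1 + y) * p) + (t * (1 + y) * p) ^ 2) -
    y * s * (1 + y) * x * (x * (y * N) + t * (1 + y) * p) + b * t * (1 + y) ^ 2 * x ^ 2 * y :=
    ⟨_, rfl⟩
  refine ⟨(1 + t * x * (1 + y) * Q) * K +
    (x * y - t * (1 + y) * (x ^ 2 + y)) * (t * (1 + y) * p), ?_⟩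
  rw [mul_add, ← mul_assoc κ, ← hZ, hK, hκ, invariantY]
  linear_combination (-y * (1 + y) ^ 3 * t ^ 2) * hX

/-- The generating function of Gessel walks ending on the second axis yields a solution of a cubic
equation with one catalytic variable. -/
theorem exists_cubic : ∃ (N : (Polynomial ℚ)⟦X⟧) (b c : ℚ⟦X⟧), constantCoeff N = 1 ∧
    invariantY (C Polynomial.X) X
      (constHom (1 + 2 * X ^ 2 * PowerSeries.mk fun n => (gesselCount n 0 0 : ℚ)))
      (constHom b) N = constHom c * X ^ 2 * (1 + C Polynomial.X) ^ 3 := by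
  obtain ⟨A₁, hA⟩ := exists_eq_constHom_add (zeroY walkSeries)
  obtain ⟨A₂, hA₁⟩ := exists_eq_constHom_add A₁
  obtain ⟨B', hB⟩ := exists_eq_constHom_add (zeroX walkSeries)
  rw [constCoeffHom_zeroX, constCoeffHom_zeroY_walkSeries] at hB
  have h := kernel_mul_walkSeries
  rw [constCoeffHom_zeroY_walkSeries] at h hA
  generalize (PowerSeries.mk fun n => (gesselCount n 0 0 : ℚ)) = a₀ at *
  generalize constCoeffHom A₁ = a₁ at *
  obtain ⟨N, hN⟩ : ∃ N, N = 1 - X ^ 2 * (1 + C Polynomial.X) ^ 2 * B' -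
    X ^ 2 * (1 + C Polynomial.X) * constHom a₀ := ⟨_, rfl⟩
  obtain ⟨f, hf⟩ : ∃ f, f = invariantX (C Polynomial.X) X (constHom a₀) (constHom a₁) A₂ :=
    ⟨_, rfl⟩
  refine ⟨N, invariantB X a₀ a₁, constCoeffHom f, by simp [hN], ?_⟩
  have hd : kernel ∣ varY * (varX * (varX * (varX * (inclY (invariantY (C Polynomial.X) X
      (constHom (invariantS X a₀)) (constHom (invariantB X a₀ a₁)) N) -
        (1 + varY) ^ 3 * inclX (X ^ 2 * f))))) := by
    convert kernel_dvd_invariants (κ := kernel) (x := varX) (y := varY) (t := X) (Q := walkSeries)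
      (a₀ := inclX (constHom a₀)) (a₁ := inclX (constHom a₁)) (a₂ := inclX A₂)
      (b' := inclY B') rfl ?_ using 6
    · rw [hN]
      simp only [invariantY, invariantS, invariantB, map_add, map_sub, map_mul, map_pow, map_one,
        map_ofNat, inclX_constHom, map_X, map_C, Polynomial.coe_mapRingHom, Polynomial.map_X]
    · rw [hf]
      simp only [invariantX, invariantS, invariantB, map_add, map_sub, map_mul, map_pow, map_one,
        map_neg, map_ofNat, map_X, map_C]
    · rw [h, hA, hA₁, hB]
      simp only [map_add, map_mul, inclX_constHom, map_C, Polynomial.coe_mapRingHom,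
        Polynomial.map_X]
  have hi := eq_zero_of_kernel_dvd _ _ _ (kernel_dvd_of_varX_mul (kernel_dvd_of_varX_mul
    (kernel_dvd_of_varX_mul (kernel_dvd_of_varY_mul hd))))
  have := congrArg zeroX hi
  rw [zeroX_inclY, map_mul, zeroX_inclX] at this
  refine this.trans ?_
  simp only [map_add, map_mul, map_pow, map_one, map_X, map_C, Polynomial.coe_mapRingHom,
    Polynomial.map_X]
  ring

/-- The derivation `X d/dX`. -/
noncomputable def eulerDerivation : Derivation ℚ ℚ⟦X⟧ ℚ⟦X⟧ := (X : ℚ⟦X⟧) • PowerSeries.derivative ℚ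

theorem coeff_eulerDerivation (f : ℚ⟦X⟧) (n : ℕ) : coeff n (eulerDerivation f) = n * coeff n f := by
  cases n with
  | zero => simp [eulerDerivation]
  | succ n => simp [eulerDerivation, coeff_succ_X_mul, coeff_derivative]; ring

theorem eulerDerivation_X : eulerDerivation X = X := by simp [eulerDerivation]

theorem recurrence_of_ode {a : ℕ → ℚ} {s : ℚ⟦X⟧} (hs : s = 1 + 2 * X ^ 2 * mk a)
    (h : 3 * eulerDerivation (eulerDerivation s) - 2 * eulerDerivation s =
      16 * X ^ 2 * (3 * eulerDerivation (eulerDerivation s) - 4 * eulerDerivation s + s)) (n : ℕ) :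
    (n + 4) * (3 * n + 10) * a (n + 2) = 16 * (n + 1) * (3 * n + 5) * a n := by
  have key (m : ℕ) : coeff (m + 2) s = 2 * a m := by
    rw [hs, show (2 : ℚ⟦X⟧) = C 2 from (map_ofNat C 2).symm, mul_assoc, map_add, coeff_C_mul,
      coeff_X_pow_mul, coeff_mk, coeff_one]
    simp
  have := congrArg (coeff (n + 2 + 2)) h
  have e (k : ℕ) [k.AtLeastTwo] : (OfNat.ofNat k : ℚ⟦X⟧) = C (OfNat.ofNat k) := (map_ofNat C k).symm
  rw [e 3, e 2, e 16, e 4, mul_assoc, coeff_C_mul, coeff_X_pow_mul] at this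
  simp only [map_add, map_sub, coeff_C_mul, coeff_eulerDerivation, key] at this
  push_cast at this
  linarith

theorem closed_form {a : ℕ → ℚ} (h0 : a 0 = 1) (h1 : a 1 = 0)
    (h : ∀ n : ℕ, ((n : ℚ) + 4) * (3 * n + 10) * a (n + 2) = 16 * (n + 1) * (3 * n + 5) * a n)
    (n : ℕ) :
    a (2 * n) = 16^n * (ascPochhammer ℚ n).eval (5/6) * (ascPochhammer ℚ n).eval (1/2) /
        ((ascPochhammer ℚ n).eval (5/3) * (ascPochhammer ℚ n).eval 2) ∧ a (2 * n + 1) = 0 := by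
  induction n with
  | zero => simp [h0, h1]
  | succ n ih =>
    constructor
    · have p₁ := (ascPochhammer_pos n (5 / 3 : ℚ) (by norm_num)).ne'
      have p₂ := (ascPochhammer_pos n (2 : ℚ) (by norm_num)).ne'
      have := h (2 * n)
      rw [ih.1] at this
      push_cast at this
      have q₁ : (5 / 3 + n : ℚ) ≠ 0 := by positivity
      have q₂ : (2 + n : ℚ) ≠ 0 := by positivity
      have q₃ : ((2 * n : ℚ) + 4) * (3 * (2 * n) + 10) ≠ 0 := by positivity
      refine mul_left_cancel₀ q₃ (this.trans ?_)
      simp only [ascPochhammer_succ_eval]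
      field_simp
      ring
    · have := h (2 * n + 1)
      rw [ih.2] at this
      have q : ((2 * n + 1 : ℕ) + 4 : ℚ) * (3 * (2 * n + 1 : ℕ) + 10) ≠ 0 := by positivity
      exact (mul_eq_zero.1 (this.trans (mul_zero _))).resolve_left q

end GeneratingFunctions

/-- Gessel's conjecture: the number of Gessel walks of length `2n` ending at the origin is
`16^n (5/6)_n (1/2)_n / ((5/3)_n (2)_n)`, and there are no such walks of odd length. -/
theorem gessel_conjecture (n : ℕ) :
    (gesselCount (2*n) 0 0 : ℚ) =
      16^n * (ascPochhammer ℚ n).eval (5/6) * (ascPochhammer ℚ n).eval (1/2) /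
        ((ascPochhammer ℚ n).eval (5/3) * (ascPochhammer ℚ n).eval 2) ∧
    gesselCount (2*n+1) 0 0 = 0 := by
  obtain ⟨N, b, c, hN, h⟩ := exists_cubic
  obtain ⟨d, cd, sd, hd⟩ := exists_param_of_cubic N _ b c hN h
  obtain ⟨p, g, cp, hg, hX, hs⟩ := exists_uniformization cd sd hd
  obtain ⟨h₀, h₁⟩ := closed_form (a := fun n => (gesselCount n 0 0 : ℚ)) (by simp [gesselCount])
    (by simp [gesselCount])
    (recurrence_of_ode rfl (ode cp hg hX hs eulerDerivation eulerDerivation_X)) n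
  exact ⟨h₀, by exact_mod_cast h₁⟩
end

section
/- The series A = t·Σ_{n≥0} q(1,0;n) tⁿ satisfies, in ℚ[[t]], the quartic equation 729 t⁶ A⁴ + 243 t⁴ (4t²+1) A³ − 27 t² (14t⁴ + 19t² − 1) A² − (20t²−1)(7t²−6t+1)(7t²+6t+1) A − t²(343t⁴ − 37t² + 1) = 0. -/
/-- `A = t·Σ_n q(1,0;n) tⁿ ∈ ℚ[[t]]`, i.e. `R′(0)` where `R(x) = t(Q(x,0;t) − Q(0,0;t))`. -/
noncomputable def Aq : PowerSeries ℚ :=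
  PowerSeries.X * PowerSeries.mk fun n => (gesselCount n 1 0 : ℚ)

namespace Gessel

open Polynomial

theorem gesselCount_eq_zero {n i j : ℕ} (h : n < i ∨ n < j) : gesselCount n i j = 0 := by
  induction n generalizing i j with
  | zero => simp only [gesselCount]; rw [if_neg]; omega
  | succ n ih =>
    simp only [gesselCount]
    rw [ih (i := i + 1) (j := j) (by omega), ih (i := i + 1) (j := j + 1) (by omega)]
    split_ifs <;> simp only [add_zero, zero_add, Nat.add_eq_zero_iff] <;>
      first
      | rfl
      | exact ⟨ih (by omega), ih (by omega)⟩
      | exact ih (by omega)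

/-- The generating polynomial of the Gessel walks with `n` steps; the outer variable records the
ordinate of the endpoint and the inner one its abscissa. -/
noncomputable def walkPoly (n : ℕ) : ℚ[X][X] :=
  ∑ j ∈ Finset.range (n + 1), ∑ i ∈ Finset.range (n + 1),
    monomial j (monomial i (gesselCount n i j : ℚ))

theorem coeff_coeff_walkPoly (n i j : ℕ) :
    ((walkPoly n).coeff j).coeff i = gesselCount n i j := by
  simp only [walkPoly, finsetSum_coeff, coeff_monomial, apply_ite (fun p : ℚ[X] => p.coeff i),
    coeff_zero]
  by_cases hj : j ∈ Finset.range (n + 1)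
  · rw [Finset.sum_eq_single_of_mem j hj fun b _ hb => by simp [hb]]
    simp only [if_true, Finset.sum_ite_eq', Finset.mem_range]
    split_ifs
    · rfl
    · rw [gesselCount_eq_zero (by omega), Nat.cast_zero]
  · rw [Finset.mem_range] at hj
    rw [gesselCount_eq_zero (by omega), Nat.cast_zero]
    refine Finset.sum_eq_zero fun k hk => Finset.sum_eq_zero fun l _ => if_neg ?_
    rintro rfl
    exact hj (Finset.mem_range.mp hk)

theorem walkPoly_zero : walkPoly 0 = 1 := by
  simp [walkPoly, gesselCount]

theorem walkPoly_succ (n : ℕ) :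
    C X * X * walkPoly (n + 1) = (1 + X) * (C X ^ 2 * X + 1) * walkPoly n
      - C ((walkPoly n).eval 0 - C (((walkPoly n).eval 0).eval 0))
      - (1 + X) * ((walkPoly n).map (evalRingHom 0)).map C := by
  have e : (1 + X) * (C X ^ 2 * X + 1) * walkPoly n =
      C X * (C X * (X * walkPoly n)) + C X * (C X * (X * (X * walkPoly n)))
        + X * walkPoly n + walkPoly n := by
    ring
  rw [e, add_mul, one_mul, mul_assoc]
  have h0 : (walkPoly n).eval 0 = (walkPoly n).coeff 0 := (coeff_zero_eq_eval_zero _).symm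
  have h1 (p : ℚ[X]) : p.eval 0 = p.coeff 0 := (coeff_zero_eq_eval_zero _).symm
  ext j i
  rcases j with _ | _ | j <;> rcases i with _ | _ | i <;>
    simp [h0, h1, coeff_C, coeff_coeff_walkPoly, gesselCount, coeff_X_mul] <;>
    ring

/-- A cubic `z³ + e₁z² + sz + e₃` with a double root has vanishing discriminant. -/
theorem discr_eq_zero_of_double_root {K : Type*} [CommRing K] {e₁ e₃ s z : K}
    (h : z ^ 3 + e₁ * z ^ 2 + s * z + e₃ = 0) (h' : 3 * z ^ 2 + 2 * e₁ * z + s = 0) :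
    -4 * s ^ 3 + e₁ ^ 2 * s ^ 2 + 18 * e₁ * e₃ * s - 4 * e₁ ^ 3 * e₃ - 27 * e₃ ^ 2 = 0 := by
  obtain rfl : s = -(3 * z ^ 2 + 2 * e₁ * z) := by linear_combination h'
  obtain rfl : e₃ = 2 * z ^ 3 + e₁ * z ^ 2 := by linear_combination h
  ring

/-- Vieta's relations for the discriminant, seen as a polynomial in `s`. -/
theorem vieta_discr {K : Type*} [Field K] {E q d s₁ s₂ s₃ : K}
    (h₁ : -4 * s₁ ^ 3 + E * s₁ ^ 2 + 18 * q * s₁ - d = 0)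
    (h₂ : -4 * s₂ ^ 3 + E * s₂ ^ 2 + 18 * q * s₂ - d = 0)
    (h₃ : -4 * s₃ ^ 3 + E * s₃ ^ 2 + 18 * q * s₃ - d = 0)
    (h₁₂ : s₁ - s₂ ≠ 0) (h₁₃ : s₁ - s₃ ≠ 0) (h₂₃ : s₂ - s₃ ≠ 0) :
    E = 4 * (s₁ + s₂ + s₃) ∧ 18 * q = -4 * (s₁ * s₂ + s₁ * s₃ + s₂ * s₃) ∧
      d = -4 * (s₁ * s₂ * s₃) := by
  have k₁₂ : -4 * (s₁ ^ 2 + s₁ * s₂ + s₂ ^ 2) + E * (s₁ + s₂) + 18 * q = 0 :=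
    (mul_eq_zero.mp (by linear_combination h₁ - h₂ : (s₁ - s₂) * _ = 0)).resolve_left h₁₂
  have k₁₃ : -4 * (s₁ ^ 2 + s₁ * s₃ + s₃ ^ 2) + E * (s₁ + s₃) + 18 * q = 0 :=
    (mul_eq_zero.mp (by linear_combination h₁ - h₃ : (s₁ - s₃) * _ = 0)).resolve_left h₁₃
  have k : -4 * (s₁ + s₂ + s₃) + E = 0 :=
    (mul_eq_zero.mp (by linear_combination k₁₂ - k₁₃ : (s₂ - s₃) * _ = 0)).resolve_left h₂₃
  obtain rfl : E = 4 * (s₁ + s₂ + s₃) := by linear_combination k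
  have hq : 18 * q = -4 * (s₁ * s₂ + s₁ * s₃ + s₂ * s₃) := by linear_combination k₁₂
  exact ⟨rfl, hq, by linear_combination -h₁ + s₁ * hq⟩

/-- If the cubic `tZ³ - (1 + tm)Z² + (2t + m - 2tA + V)Z - (γ + mV)` has a double root when
`V = 2 - 4t`, `V = -2 - 4t` and `V = 1/(4t)`, then `A` satisfies a quartic equation over `ℚ(t)`. -/
theorem quartic_of_double_roots {K : Type*} [Field K] [CharZero K] {t m A γ l₁ l₂ l₃ : K}
    (ht : t ≠ 0) (h₁₃ : 8 * t ≠ 1 + 16 * t ^ 2) (h₂₃ : -8 * t ≠ 1 + 16 * t ^ 2)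
    (p₁ : (l₁ - m) * (2 - 4 * t) + t * l₁ ^ 3 - (1 + t * m) * l₁ ^ 2
      + (2 * t + m - 2 * t * A) * l₁ = γ)
    (p₁' : (2 - 4 * t) + 3 * t * l₁ ^ 2 - 2 * (1 + t * m) * l₁ + (2 * t + m - 2 * t * A) = 0)
    (p₂ : (l₂ - m) * (-2 - 4 * t) + t * l₂ ^ 3 - (1 + t * m) * l₂ ^ 2
      + (2 * t + m - 2 * t * A) * l₂ = γ)
    (p₂' : (-2 - 4 * t) + 3 * t * l₂ ^ 2 - 2 * (1 + t * m) * l₂ + (2 * t + m - 2 * t * A) = 0)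
    (p₃ : (l₃ - m) * (1 / (4 * t)) + t * l₃ ^ 3 - (1 + t * m) * l₃ ^ 2
      + (2 * t + m - 2 * t * A) * l₃ = γ)
    (p₃' : 1 / (4 * t) + 3 * t * l₃ ^ 2 - 2 * (1 + t * m) * l₃ + (2 * t + m - 2 * t * A) = 0) :
    729 * t ^ 6 * A ^ 4 + 243 * t ^ 4 * (4 * t ^ 2 + 1) * A ^ 3
      - 27 * t ^ 2 * (14 * t ^ 4 + 19 * t ^ 2 - 1) * A ^ 2
      - (20 * t ^ 2 - 1) * (7 * t ^ 2 - 6 * t + 1) * (7 * t ^ 2 + 6 * t + 1) * A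
      - t ^ 2 * (343 * t ^ 4 - 37 * t ^ 2 + 1) = 0 := by
  set e₁ := 2 * m - 1 / t with he₁
  set e₂ := m ^ 2 - m / t + 2 - 2 * A with he₂
  set e₃ := (t * m ^ 3 - (1 + t * m) * m ^ 2 + (2 * t + m - 2 * t * A) * m - γ) / t with he₃
  have key (V l : K) (p : (l - m) * V + t * l ^ 3 - (1 + t * m) * l ^ 2
      + (2 * t + m - 2 * t * A) * l = γ)
      (p' : V + 3 * t * l ^ 2 - 2 * (1 + t * m) * l + (2 * t + m - 2 * t * A) = 0) :
      -4 * (e₂ + V / t) ^ 3 + e₁ ^ 2 * (e₂ + V / t) ^ 2 + 18 * (e₁ * e₃) * (e₂ + V / t)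
        - (4 * e₁ ^ 3 * e₃ + 27 * e₃ ^ 2) = 0 := by
    rw [← discr_eq_zero_of_double_root (e₁ := e₁) (e₃ := e₃) (s := e₂ + V / t) (z := l - m)]
    · ring
    · rw [he₁, he₂, he₃]
      field_simp
      linear_combination p
    · rw [he₁, he₂]
      field_simp
      linear_combination p'
  obtain ⟨hE, hq, hd⟩ := vieta_discr (key _ _ p₁ p₁') (key _ _ p₂ p₂') (key _ _ p₃ p₃')
    (by field_simp; norm_num [ht])
    (by
      intro h
      apply h₁₃
      field_simp at h
      linear_combination h)
    (by
      intro h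
      apply h₂₃
      field_simp at h
      linear_combination h)
  have v₁ : (2 - 4 * t) / t = 2 / t - 4 := by field_simp
  have v₂ : (-2 - 4 * t) / t = -2 / t - 4 := by field_simp
  have v₃ : 1 / (4 * t) / t = (1 / t) ^ 2 / 4 := by field_simp
  rw [v₁, v₂, v₃] at hE hq hd
  have hA : m ^ 2 - m / t = 3 * A + 1 := by
    rw [he₁, he₂] at hE
    linear_combination (-1 / 8) * hE
  have h₂ : e₂ = A + 3 := by rw [he₂, hA]; ring
  have hE' : e₁ ^ 2 = 12 * A + 4 + 1 / t ^ 2 := by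
    rw [he₁]
    linear_combination 4 * hA
  have hq' : e₁ * e₃ = -(2 / 9) * ((A + 3 + (2 / t - 4)) * (A + 3 + (-2 / t - 4))
      + (A + 3 + (2 / t - 4)) * (A + 3 + (1 / t) ^ 2 / 4)
      + (A + 3 + (-2 / t - 4)) * (A + 3 + (1 / t) ^ 2 / 4)) := by
    rw [h₂] at hq
    linear_combination hq / 18
  have hEd : 4 * (e₁ ^ 2) ^ 2 * (e₁ * e₃) + 27 * (e₁ * e₃) ^ 2
      = -4 * e₁ ^ 2 * ((A + 3 + (2 / t - 4)) * (A + 3 + (-2 / t - 4))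
        * (A + 3 + (1 / t) ^ 2 / 4)) := by
    rw [h₂] at hd
    linear_combination e₁ ^ 2 * hd
  rw [hE', hq'] at hEd
  field_simp at hEd
  refine mul_left_cancel₀ (mul_ne_zero (by norm_num : (576 : K) ≠ 0) ht) ?_
  linear_combination -hEd

section Invariants

variable {B : Type*} [CommRing B]

/-- The kernel polynomial of the walk. -/
def kernel (t x y : B) : B := x * y - t * ((1 + y) * (x ^ 2 * y + 1))

/-- The invariant `t((L - m)I + L³ + aL² + bL)`, where `L = 1/x + Ax + R₂x²`, `m = -tq` and
`I = (x + 1/x)/t - (x + 1/x)²`, the coefficients `a`, `b` being chosen so that the pole at `x = 0`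
vanishes. -/
def xInvariant (t x q A R₂ : B) : B :=
  1 - t * x + t * q * (-2 * t + x - t * x ^ 2) + 2 * t * R₂
    + (A + x * R₂) * (1 - 2 * t * x + x ^ 2 - t * x ^ 3)
    + 3 * t * x * (A + x * R₂) ^ 2 + t * x ^ 3 * (A + x * R₂) ^ 3
    - (1 - t ^ 2 * q) * (2 * (A + x * R₂) + x ^ 2 * (A + x * R₂) ^ 2)
    + (2 * t - t * q - 2 * t * A) * x * (A + x * R₂)

/-- The series `t(1+y)M`, where `M = y/(t(1+y)) - t(1+y)(q + yQ₁)`. -/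
def yNumerator (t y q Q₁ : B) : B := y - t ^ 2 * (1 + y) ^ 2 * (q + y * Q₁)

/-- The invariant `t³(1+y)³((M - m)J + M³ + aM² + bM)`, where `M = y/(t(1+y)) - t(1+y)(q + yQ₁)`
and `J = y/(t(1+y))² + y + 1/y - 2`. -/
def yInvariant (t y q A Q₁ : B) : B :=
  (1 - t ^ 2 * (1 + y) * (q + (1 + y) * Q₁)) * (y ^ 2 + t ^ 2 * (1 + y) ^ 2 * (y - 1) ^ 2)
    + yNumerator t y q Q₁ ^ 3 - (1 - t ^ 2 * q) * yNumerator t y q Q₁ ^ 2 * (1 + y)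
    + t * (2 * t - t * q - 2 * t * A) * yNumerator t y q Q₁ * (1 + y) ^ 2

theorem map_kernel {B' : Type*} [CommRing B'] (φ : B →+* B') (t x y : B) :
    φ (kernel t x y) = kernel (φ t) (φ x) (φ y) := by
  simp [kernel]

theorem map_xInvariant {B' : Type*} [CommRing B'] (φ : B →+* B') (t x q A R₂ : B) :
    φ (xInvariant t x q A R₂) = xInvariant (φ t) (φ x) (φ q) (φ A) (φ R₂) := by
  simp [xInvariant, map_ofNat]

theorem map_yInvariant {B' : Type*} [CommRing B'] (φ : B →+* B') (t y q A Q₁ : B) :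
    φ (yInvariant t y q A Q₁) = yInvariant (φ t) (φ y) (φ q) (φ A) (φ Q₁) := by
  simp [yInvariant, yNumerator, map_ofNat]

theorem pow_mul_xInvariant {t x q A R₂ l : B} (hl : l = 1 + x ^ 2 * (A + x * R₂)) :
    x ^ 3 * xInvariant t x q A R₂ =
      (l + x * (t * q)) * (x + x ^ 3 - t * (1 + x ^ 2) ^ 2) + t * l ^ 3
        - (1 - t ^ 2 * q) * l ^ 2 * x + (2 * t - t * q - 2 * t * A) * l * x ^ 2 := by
  subst hl
  simp only [xInvariant]
  ring

theorem mul_yInvariant {t y q A Q₁ u : B} (hu : u = yNumerator t y q Q₁) :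
    y * yInvariant t y q A Q₁ =
      (u + t ^ 2 * (1 + y) * q) * (y ^ 2 + t ^ 2 * (1 + y) ^ 2 * (y - 1) ^ 2)
        + y * (u ^ 3 - (1 - t ^ 2 * q) * u ^ 2 * (1 + y)
          + t * (2 * t - t * q - 2 * t * A) * u * (1 + y) ^ 2) := by
  rw [yInvariant, ← hu]
  rw [yNumerator] at hu
  linear_combination -(y ^ 2 + t ^ 2 * (1 + y) ^ 2 * (y - 1) ^ 2) * hu

theorem exists_kernel_mul_eq {t x y q A R₂ Q₁ Q : B}
    (hQ : kernel t x y * Q = x * y - x * (A + x * R₂) - t * (1 + y) * (q + y * Q₁)) :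
    ∃ N, kernel t x y * N =
      x ^ 3 * y * (t ^ 2 * (1 + y) ^ 3 * xInvariant t x q A R₂ - yInvariant t y q A Q₁) := by
  obtain ⟨l, hl⟩ : ∃ l, l = 1 + x ^ 2 * (A + x * R₂) := ⟨_, rfl⟩
  obtain ⟨u, hu⟩ : ∃ u, u = yNumerator t y q Q₁ := ⟨_, rfl⟩
  have hF := pow_mul_xInvariant (t := t) (q := q) hl
  have hG := mul_yInvariant (A := A) hu
  have hK : kernel t x y = x * y - t * ((1 + y) * (x ^ 2 * y + 1)) := rfl
  have hlu : t * (1 + y) * l - x * u = -kernel t x y * (t * x * (1 + y) * Q + 1) := by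
    rw [hl, hu, yNumerator]
    linear_combination t * x * (1 + y) * hQ
      + hK
  refine ⟨-(t * x * (1 + y) * Q + 1) * (t * (1 + y) ^ 2 * (x + x ^ 3 - t * (1 + x ^ 2) ^ 2)
      + t ^ 2 * (1 + y) ^ 2 * l ^ 2 + t * x * (1 + y) * l * u + x ^ 2 * u ^ 2
      - (1 - t ^ 2 * q) * x * (1 + y) * (t * (1 + y) * l + x * u)
      + t * (2 * t - t * q - 2 * t * A) * x ^ 2 * (1 + y) ^ 2) * y
      + x * (u + t ^ 2 * (1 + y) * q)
        * (t * (1 + x ^ 2) * (1 + y) ^ 2 + kernel t x y - 2 * x * y), ?_⟩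
  generalize kernel t x y = k at hK hlu ⊢
  have e : x ^ 3 * y * (t ^ 2 * (1 + y) ^ 3 * xInvariant t x q A R₂ - yInvariant t y q A Q₁) =
      t ^ 2 * (1 + y) ^ 3 * y * (x ^ 3 * xInvariant t x q A R₂)
        - x ^ 3 * (y * yInvariant t y q A Q₁) := by ring
  rw [e, hF, hG]
  subst hK
  linear_combination -((t * (1 + y) ^ 2 * (x + x ^ 3 - t * (1 + x ^ 2) ^ 2)
      + t ^ 2 * (1 + y) ^ 2 * l ^ 2 + t * x * (1 + y) * l * u + x ^ 2 * u ^ 2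
      - (1 - t ^ 2 * q) * x * (1 + y) * (t * (1 + y) * l + x * u)
      + t * (2 * t - t * q - 2 * t * A) * x ^ 2 * (1 + y) ^ 2) * y) * hlu

end Invariants

section DoubleRoots

variable {A B : Type*} [CommRing A] [Algebra ℚ A] [CommRing B] [IsDomain B]

/-- If `tL³ + αL² + (β + V)L = γ + mV` where `L = l/x` and `V = t((x + 1/x)/t - (x + 1/x)²)`, then
this cubic has a double root at `x = s` for `s = ±1`, the critical points of `V`. -/
theorem double_root_of_x_equation (d : Derivation ℚ A A) (ev : A →+* B)
    {t x m α β γ l : A} {s : B}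
    (ht : d t = 0) (hx : d x = 1) (hm : d m = 0) (hα : d α = 0) (hβ : d β = 0) (hγ : d γ = 0)
    (hs : ev x = s) (hs' : s = 1 ∨ s = -1)
    (h : (l - x * m) * (x + x ^ 3 - t * (1 + x ^ 2) ^ 2) + t * l ^ 3 + α * l ^ 2 * x
      + β * l * x ^ 2 = x ^ 3 * γ)
    (hl : s * ev (d l) - ev l ≠ 0) :
    (s * ev l - ev m) * (2 * s - 4 * ev t) + ev t * (s * ev l) ^ 3 + ev α * (s * ev l) ^ 2
        + ev β * (s * ev l) = ev γ ∧
      (2 * s - 4 * ev t) + 3 * ev t * (s * ev l) ^ 2 + 2 * ev α * (s * ev l) + ev β = 0 := by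
  have h' := congrArg (fun a => ev (d a)) h
  have h₀ := congrArg ev h
  simp only [map_add, map_sub, map_mul, map_pow, map_one, hs] at h₀
  simp [Derivation.leibniz, Derivation.leibniz_pow, ht, hx, hm, hα, hβ, hγ, hs, map_ofNat] at h'
  constructor
  · rcases hs' with rfl | rfl
    · linear_combination h₀
    · linear_combination -h₀
  · refine (mul_eq_zero.mp (?_ : (s * ev (d l) - ev l) * _ = 0)).resolve_left hl
    rcases hs' with rfl | rfl
    · linear_combination h' - 3 * h₀
    · linear_combination -h' - 3 * h₀

/-- If `tM³ + αM² + (β + W)M = γ + mW` where `M = u/(t(1+y))` and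
`W = t(y/(t(1+y))² + y + 1/y - 2)`, then this cubic has a double root at `y = 1`, a critical point
of `W`. -/
theorem double_root_of_y_equation (d : Derivation ℚ A A) (ev : A →+* B)
    {t y m α β γ u : A}
    (ht : d t = 0) (hy : d y = 1) (hm : d m = 0) (hα : d α = 0) (hβ : d β = 0) (hγ : d γ = 0)
    (hs : ev y = 1)
    (h : (u - t * (1 + y) * m) * (y ^ 2 + t ^ 2 * (1 + y) ^ 2 * (y - 1) ^ 2)
      + y * (u ^ 3 + α * u ^ 2 * (1 + y) + t * β * u * (1 + y) ^ 2) = y * t ^ 2 * (1 + y) ^ 3 * γ)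
    (hu : 2 * ev (d u) - ev u ≠ 0) :
    (ev u - 2 * ev t * ev m) + ev u ^ 3 + 2 * ev α * ev u ^ 2 + 4 * ev t * ev β * ev u
        = 8 * ev t ^ 2 * ev γ ∧
      1 + 3 * ev u ^ 2 + 4 * ev α * ev u + 4 * ev t * ev β = 0 := by
  have h' := congrArg (fun a => ev (d a)) h
  have h₀ := congrArg ev h
  simp only [map_add, map_sub, map_mul, map_pow, map_one, hs] at h₀
  simp [Derivation.leibniz, Derivation.leibniz_pow, ht, hy, hm, hα, hβ, hγ, hs, map_ofNat] at h'
  refine ⟨by linear_combination h₀,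
    (mul_eq_zero.mp (?_ : (2 * ev (d u) - ev u) * _ = 0)).resolve_left hu⟩
  linear_combination 2 * h' - 5 * h₀

end DoubleRoots

section Series

theorem exists_eq_C_mul {S : Type*} [CommRing S] (a : S) (f : PowerSeries S)
    (h : ∀ n, a ∣ PowerSeries.coeff n f) : ∃ g, f = PowerSeries.C a * g := by
  choose g hg using h
  exact ⟨PowerSeries.mk g, by ext n; simp [hg]⟩

theorem exists_eq_C_X_mul {S : Type*} [CommRing S] (f : PowerSeries S[X])
    (h : PowerSeries.map (evalRingHom 0) f = 0) : ∃ g, f = PowerSeries.C X * g := by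
  refine exists_eq_C_mul _ _ fun n => ?_
  rw [X_dvd_iff, coeff_zero_eq_eval_zero]
  simpa using congrArg (PowerSeries.coeff n) h

theorem exists_eq_C_C_X_mul {S : Type*} [CommRing S] (f : PowerSeries S[X][X])
    (h : PowerSeries.map (mapRingHom (evalRingHom 0)) f = 0) :
    ∃ g, f = PowerSeries.C (C X) * g := by
  refine exists_eq_C_mul _ _ fun n => ?_
  rw [C_dvd_iff_dvd_coeff]
  intro i
  rw [X_dvd_iff, coeff_zero_eq_eval_zero]
  simpa using congrArg (fun g => (PowerSeries.coeff n g).coeff i) h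

/-- The kernel, as a power series in `t` with coefficients in `ℚ[x][y]`. -/
noncomputable def kernelSeries : PowerSeries ℚ[X][X] :=
  kernel PowerSeries.X (PowerSeries.C (C X)) (PowerSeries.C X)

theorem kernelSeries_eq : kernelSeries =
    PowerSeries.C (C X * X) - PowerSeries.X * PowerSeries.C ((1 + X) * (C X ^ 2 * X + 1)) := by
  simp [kernelSeries, kernel]

theorem coeff_zero_kernelSeries_mul (f : PowerSeries ℚ[X][X]) :
    PowerSeries.coeff 0 (kernelSeries * f) = C X * X * PowerSeries.coeff 0 f := by
  simp [kernelSeries_eq, sub_mul, mul_assoc]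

theorem coeff_succ_kernelSeries_mul (n : ℕ) (f : PowerSeries ℚ[X][X]) :
    PowerSeries.coeff (n + 1) (kernelSeries * f) =
      C X * X * PowerSeries.coeff (n + 1) f
        - (1 + X) * (C X ^ 2 * X + 1) * PowerSeries.coeff n f := by
  rw [kernelSeries_eq, sub_mul, mul_assoc, map_sub, PowerSeries.coeff_succ_X_mul,
    PowerSeries.coeff_C_mul, PowerSeries.coeff_C_mul]

theorem exists_eq_kernelSeries_mul_of_C_X_mul {f N : PowerSeries ℚ[X][X]}
    (h : kernelSeries * N = PowerSeries.C X * f) : ∃ N', f = kernelSeries * N' := by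
  have h0 := congrArg (PowerSeries.map (evalRingHom 0)) h
  simp only [kernelSeries, map_mul, map_kernel, PowerSeries.map_X, PowerSeries.map_C,
    coe_evalRingHom, eval_X, eval_C, map_zero, zero_mul] at h0
  obtain ⟨N', rfl⟩ := exists_eq_C_X_mul N (by simpa [kernel, PowerSeries.X_ne_zero] using h0)
  refine ⟨N', mul_left_cancel₀ (a := PowerSeries.C X) ?_ ?_⟩
  · exact (map_ne_zero_iff _ PowerSeries.C_injective).mpr (by simp)
  · rw [← h]; ring

theorem exists_eq_kernelSeries_mul_of_C_C_X_mul {f N : PowerSeries ℚ[X][X]}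
    (h : kernelSeries * N = PowerSeries.C (C X) * f) : ∃ N', f = kernelSeries * N' := by
  have h0 := congrArg (PowerSeries.map (mapRingHom (evalRingHom 0))) h
  simp only [kernelSeries, map_mul, map_kernel, PowerSeries.map_X, PowerSeries.map_C,
    coe_mapRingHom, map_X, map_C, coe_evalRingHom, eval_X, map_zero, zero_mul] at h0
  have h1 : (1 + X : ℚ[X]) ≠ 0 := by
    rw [add_comm]; exact X_add_C_ne_zero 1
  have h2 : (1 + PowerSeries.C X : PowerSeries ℚ[X]) ≠ 0 := by
    rw [← map_one PowerSeries.C, ← map_add]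
    exact (map_ne_zero_iff _ PowerSeries.C_injective).mpr h1
  obtain ⟨N', rfl⟩ := exists_eq_C_C_X_mul N
    (by simpa [kernel, PowerSeries.X_ne_zero, h2] using h0)
  refine ⟨N', mul_left_cancel₀ (a := PowerSeries.C (C X)) ?_ ?_⟩
  · exact (map_ne_zero_iff _ PowerSeries.C_injective).mpr (by simp)
  · rw [← h]; ring

theorem eq_zero_of_separated {f g : ℚ[X]} {N : ℚ[X][X]}
    (h : (1 + X) ^ 3 * C f - g.map C = C X * X * N) : N = 0 := by
  have hy := congrArg (eval 0) h
  have hx := congrArg (Polynomial.map (evalRingHom 0)) h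
  have hg : (g.map (C : ℚ →+* ℚ[X])).map (evalRingHom 0) = g := by
    ext n; simp
  have hg0 : eval 0 (g.map (C : ℚ →+* ℚ[X])) = C (g.coeff 0) := by
    rw [← coeff_zero_eq_eval_zero, coeff_map]
  simp [hg0] at hy
  simp [hg] at hx
  have hf : f = C (g.coeff 0) := by linear_combination hy
  have hg' : g = (1 + X) ^ 3 * C (eval 0 f) := by linear_combination -hx
  have hg'' : g.map C = (1 + X) ^ 3 * C f := by
    rw [hg', hf]
    simp
  rw [hg'', sub_self] at h
  simpa [X_ne_zero] using h.symm

theorem eq_zero_of_kernelSeries_mul_eq {f g : PowerSeries ℚ[X]} {N : PowerSeries ℚ[X][X]}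
    (h : (1 + PowerSeries.C X) ^ 3 * PowerSeries.map C f - PowerSeries.map (mapRingHom C) g =
      kernelSeries * N) :
    N = 0 := by
  have h' (n : ℕ) : (1 + X) ^ 3 * C (PowerSeries.coeff n f) - (PowerSeries.coeff n g).map C =
      PowerSeries.coeff n (kernelSeries * N) := by
    rw [← h, ← map_one PowerSeries.C, ← map_add, ← map_pow, map_sub, PowerSeries.coeff_C_mul,
      PowerSeries.coeff_map, PowerSeries.coeff_map, coe_mapRingHom]
  ext1 n
  rw [map_zero]
  induction n with
  | zero => exact eq_zero_of_separated ((h' 0).trans (coeff_zero_kernelSeries_mul N))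
  | succ n ih =>
    refine eq_zero_of_separated ((h' (n + 1)).trans ?_)
    rw [coeff_succ_kernelSeries_mul, ih, mul_zero, sub_zero]

/-- Coefficientwise differentiation with respect to the polynomial variable. -/
noncomputable def coeffDerivation : Derivation ℚ (PowerSeries ℚ[X]) (PowerSeries ℚ[X]) where
  toFun f := PowerSeries.mk fun n => derivative (PowerSeries.coeff n f)
  map_add' f g := by ext n : 1; simp
  map_smul' c f := by ext n : 1; simp
  map_one_eq_zero' := by
    ext n : 1
    simp [PowerSeries.coeff_one, apply_ite derivative]
  leibniz' f g := by
    ext n : 1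
    simp only [LinearMap.coe_mk, AddHom.coe_mk, PowerSeries.coeff_mk, PowerSeries.coeff_mul,
      derivative_sum, derivative_mul, Finset.sum_add_distrib, smul_eq_mul, map_add]
    rw [add_comm]
    congr 1
    rw [← Finset.Nat.sum_antidiagonal_swap]
    simp [mul_comm]

theorem coeff_coeffDerivation (n : ℕ) (f : PowerSeries ℚ[X]) :
    PowerSeries.coeff n (coeffDerivation f) = derivative (PowerSeries.coeff n f) := by
  simp [coeffDerivation]

theorem coeffDerivation_map_C (f : PowerSeries ℚ) : coeffDerivation (PowerSeries.map C f) = 0 := by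
  ext n : 1
  simp [coeff_coeffDerivation]

theorem coeffDerivation_X : coeffDerivation PowerSeries.X = 0 := by
  simpa using coeffDerivation_map_C PowerSeries.X

theorem coeffDerivation_C_X : coeffDerivation (PowerSeries.C X) = 1 := by
  ext n : 1
  simp [coeff_coeffDerivation, PowerSeries.coeff_C, PowerSeries.coeff_one, apply_ite derivative]

end Series

section Walks

/-- The generating series `Q(0,0;t)`. -/
noncomputable def originSeries : PowerSeries ℚ :=
  PowerSeries.mk fun n => ((walkPoly n).eval 0).eval 0

/-- The generating series `Q(x,0;t)`. -/
noncomputable def xAxisSeries : PowerSeries ℚ[X] :=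
  PowerSeries.mk fun n => (walkPoly n).eval 0

/-- The generating series `Q(0,y;t)`. -/
noncomputable def yAxisSeries : PowerSeries ℚ[X] :=
  PowerSeries.mk fun n => (walkPoly n).map (evalRingHom 0)

theorem kernelSeries_mul_mk_walkPoly :
    kernelSeries * PowerSeries.mk walkPoly =
      PowerSeries.C (C X) * PowerSeries.C X
        - PowerSeries.map C (PowerSeries.X * (xAxisSeries - PowerSeries.map C originSeries))
        - PowerSeries.X * ((1 + PowerSeries.C X)
          * PowerSeries.map (mapRingHom C) yAxisSeries) := by
  have e : (1 + PowerSeries.C X : PowerSeries ℚ[X][X]) = PowerSeries.C (1 + X) := by simp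
  rw [e, map_mul, PowerSeries.map_X, ← map_mul]
  ext1 n
  cases n with
  | zero =>
    simp [coeff_zero_kernelSeries_mul, walkPoly_zero]
  | succ n =>
    simp only [coeff_succ_kernelSeries_mul, map_sub, PowerSeries.coeff_succ_X_mul,
      PowerSeries.coeff_mk, PowerSeries.coeff_C_mul, PowerSeries.coeff_map, walkPoly_succ,
      xAxisSeries, originSeries, yAxisSeries, coe_mapRingHom, PowerSeries.coeff_C,
      Nat.succ_ne_zero, if_false]
    ring

theorem exists_xAxisSeries_eq : ∃ R₂ : PowerSeries ℚ[X],
    PowerSeries.X * (xAxisSeries - PowerSeries.map C originSeries) =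
      PowerSeries.C X * (PowerSeries.map C Aq + PowerSeries.C X * R₂) := by
  obtain ⟨R₁, h₁⟩ := exists_eq_C_X_mul
    (PowerSeries.X * (xAxisSeries - PowerSeries.map C originSeries)) (by
      ext n
      cases n <;> simp [PowerSeries.coeff_succ_X_mul, xAxisSeries, originSeries])
  obtain ⟨R₂, h₂⟩ := exists_eq_C_X_mul (R₁ - PowerSeries.map C Aq) (by
    ext n
    have h := congrArg (fun f => (PowerSeries.coeff n f).coeff 1) h₁
    simp only [PowerSeries.coeff_C_mul, coeff_X_mul] at h
    simp only [map_sub, PowerSeries.coeff_map, coe_evalRingHom, eval_C, map_zero,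
      ← coeff_zero_eq_eval_zero, ← h]
    cases n with
    | zero => simp [Aq]
    | succ n =>
      simp [Aq, PowerSeries.coeff_succ_X_mul, xAxisSeries, originSeries,
        ← coeff_zero_eq_eval_zero, coeff_coeff_walkPoly])
  exact ⟨R₂, by rw [h₁, ← h₂]; ring⟩

theorem exists_yAxisSeries_eq : ∃ Q₁ : PowerSeries ℚ[X],
    yAxisSeries = PowerSeries.map C originSeries + PowerSeries.C X * Q₁ := by
  obtain ⟨Q₁, h⟩ := exists_eq_C_X_mul (yAxisSeries - PowerSeries.map C originSeries) (by
    ext n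
    simp [yAxisSeries, originSeries, ← coeff_zero_eq_eval_zero])
  exact ⟨Q₁, by rw [← h]; ring⟩

theorem map_map_C_map_C (f : PowerSeries ℚ) :
    PowerSeries.map (mapRingHom C) (PowerSeries.map C f) =
      PowerSeries.map (C : ℚ[X] →+* ℚ[X][X]) (PowerSeries.map C f) := by
  ext1 n
  simp

/-- Both invariants are constant. -/
theorem exists_invariants_eq {R₂ Q₁ : PowerSeries ℚ[X]}
    (hR : PowerSeries.X * (xAxisSeries - PowerSeries.map C originSeries) =
      PowerSeries.C X * (PowerSeries.map C Aq + PowerSeries.C X * R₂))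
    (hS : yAxisSeries = PowerSeries.map C originSeries + PowerSeries.C X * Q₁) :
    ∃ γ : PowerSeries ℚ,
      xInvariant PowerSeries.X (PowerSeries.C X) (PowerSeries.map C originSeries)
        (PowerSeries.map C Aq) R₂ = PowerSeries.map C γ ∧
      yInvariant PowerSeries.X (PowerSeries.C X) (PowerSeries.map C originSeries)
        (PowerSeries.map C Aq) Q₁ =
        PowerSeries.X ^ 2 * (1 + PowerSeries.C X) ^ 3 * PowerSeries.map C γ := by
  have hQ := kernelSeries_mul_mk_walkPoly
  rw [hR, hS] at hQ
  obtain ⟨F, hF⟩ : ∃ F, F = xInvariant PowerSeries.X (PowerSeries.C X)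
    (PowerSeries.map C originSeries) (PowerSeries.map C Aq) R₂ := ⟨_, rfl⟩
  obtain ⟨G, hG⟩ : ∃ G, G = yInvariant PowerSeries.X (PowerSeries.C X)
    (PowerSeries.map C originSeries) (PowerSeries.map C Aq) Q₁ := ⟨_, rfl⟩
  rw [← hF, ← hG]
  obtain ⟨N, hN⟩ := exists_kernel_mul_eq (t := PowerSeries.X) (x := PowerSeries.C (C X))
    (y := PowerSeries.C X) (q := PowerSeries.map C (PowerSeries.map C originSeries))
    (A := PowerSeries.map C (PowerSeries.map C Aq)) (R₂ := PowerSeries.map C R₂)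
    (Q₁ := PowerSeries.map (mapRingHom C) Q₁) (Q := PowerSeries.mk walkPoly) (by
      rw [← kernelSeries, hQ]
      simp only [map_mul, map_add, PowerSeries.map_C, coe_mapRingHom, map_X, map_map_C_map_C]
      ring)
  have hF' := congrArg (PowerSeries.map (C : ℚ[X] →+* ℚ[X][X])) hF
  have hG' := congrArg (PowerSeries.map (mapRingHom (C : ℚ →+* ℚ[X]))) hG
  simp only [map_xInvariant, PowerSeries.map_X, PowerSeries.map_C] at hF'
  simp only [map_yInvariant, PowerSeries.map_X, PowerSeries.map_C, coe_mapRingHom, map_X,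
    map_map_C_map_C] at hG'
  rw [← hF', ← hG', ← kernelSeries] at hN
  obtain ⟨N₁, h₁⟩ := exists_eq_kernelSeries_mul_of_C_C_X_mul (hN.trans
    (by ring : _ = PowerSeries.C (C X) * (PowerSeries.C (C X) * (PowerSeries.C (C X) *
      (PowerSeries.C X * (PowerSeries.X ^ 2 * (1 + PowerSeries.C X) ^ 3 * PowerSeries.map C F
        - PowerSeries.map (mapRingHom C) G))))))
  obtain ⟨N₂, h₂⟩ := exists_eq_kernelSeries_mul_of_C_C_X_mul h₁.symm
  obtain ⟨N₃, h₃⟩ := exists_eq_kernelSeries_mul_of_C_C_X_mul h₂.symm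
  obtain ⟨N₄, h₄⟩ := exists_eq_kernelSeries_mul_of_C_X_mul h₃.symm
  have h₅ : N₄ = 0 := by
    refine eq_zero_of_kernelSeries_mul_eq (f := PowerSeries.X ^ 2 * F) (g := G) ?_
    rw [← h₄, map_mul, map_pow, PowerSeries.map_X]
    ring
  rw [h₅, mul_zero] at h₄
  have hx := congrArg (PowerSeries.map (mapRingHom (evalRingHom 0))) h₄
  have hGx : PowerSeries.map (mapRingHom (evalRingHom 0))
      (PowerSeries.map (mapRingHom (C : ℚ →+* ℚ[X])) G) = G := by
    ext n i
    simp
  have hFx : PowerSeries.map (mapRingHom (evalRingHom 0)) (PowerSeries.map C F) =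
      PowerSeries.map C (PowerSeries.map (evalRingHom 0) F) := by
    ext1 n
    simp
  simp only [map_sub, map_mul, map_pow, map_add, map_one, PowerSeries.map_X, PowerSeries.map_C,
    coe_mapRingHom, map_X, hGx, hFx, map_zero] at hx
  have hG'' := (sub_eq_zero.mp hx).symm
  refine ⟨PowerSeries.map (evalRingHom 0) F, ?_, hG''⟩
  rw [hG''] at h₄
  simp only [map_mul, map_pow, map_add, map_one, PowerSeries.map_X, PowerSeries.map_C,
    coe_mapRingHom, map_X, map_map_C_map_C] at h₄
  have hy := congrArg (PowerSeries.map (evalRingHom 0)) h₄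
  have hC (f : PowerSeries ℚ[X]) : PowerSeries.map (evalRingHom 0) (PowerSeries.map C f) = f := by
    ext1 n
    simp
  simp only [map_sub, map_mul, map_pow, map_add, map_one, PowerSeries.map_X, PowerSeries.map_C,
    coe_evalRingHom, eval_X, hC, map_zero, add_zero, one_pow, mul_one] at hy
  exact mul_left_cancel₀ (pow_ne_zero 2 PowerSeries.X_ne_zero) (sub_eq_zero.mp hy)

end Walks

section Specialization

theorem exists_double_root_of_xInvariant {γ : PowerSeries ℚ} {R₂ : PowerSeries ℚ[X]}
    (hR : PowerSeries.X * (xAxisSeries - PowerSeries.map C originSeries) =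
      PowerSeries.C X * (PowerSeries.map C Aq + PowerSeries.C X * R₂))
    (h : xInvariant PowerSeries.X (PowerSeries.C X) (PowerSeries.map C originSeries)
      (PowerSeries.map C Aq) R₂ = PowerSeries.map C γ)
    {s : PowerSeries ℚ} {r : ℚ} (hr : PowerSeries.C r = s) (hs : s = 1 ∨ s = -1) :
    ∃ l : PowerSeries ℚ,
      (l + PowerSeries.X * originSeries) * (2 * s - 4 * PowerSeries.X) + PowerSeries.X * l ^ 3
          - (1 - PowerSeries.X ^ 2 * originSeries) * l ^ 2
          + (2 * PowerSeries.X - PowerSeries.X * originSeries - 2 * PowerSeries.X * Aq) * l = γ ∧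
        (2 * s - 4 * PowerSeries.X) + 3 * PowerSeries.X * l ^ 2
          - 2 * (1 - PowerSeries.X ^ 2 * originSeries) * l
          + (2 * PowerSeries.X - PowerSeries.X * originSeries - 2 * PowerSeries.X * Aq) = 0 := by
  obtain ⟨l, hl⟩ : ∃ l : PowerSeries ℚ[X], l = 1 + PowerSeries.C X ^ 2 *
    (PowerSeries.map C Aq + PowerSeries.C X * R₂) := ⟨_, rfl⟩
  have e := pow_mul_xInvariant (t := PowerSeries.X) (q := PowerSeries.map C originSeries) hl
  rw [h] at e
  have hl' : l = 1 + PowerSeries.C X *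
      (PowerSeries.X * (xAxisSeries - PowerSeries.map C originSeries)) := by
    rw [hl, hR]; ring
  have hC (f : PowerSeries ℚ) : PowerSeries.map (evalRingHom r) (PowerSeries.map C f) = f := by
    ext n
    simp
  obtain ⟨e₁, e₂⟩ := double_root_of_x_equation coeffDerivation (PowerSeries.map (evalRingHom r))
    (t := PowerSeries.X) (x := PowerSeries.C X) (s := s) (l := l)
    (m := PowerSeries.map C (-(PowerSeries.X * originSeries)))
    (α := PowerSeries.map C (-(1 - PowerSeries.X ^ 2 * originSeries)))
    (β := PowerSeries.map C
      (2 * PowerSeries.X - PowerSeries.X * originSeries - 2 * PowerSeries.X * Aq))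
    (γ := PowerSeries.map C γ) coeffDerivation_X coeffDerivation_C_X (coeffDerivation_map_C _)
    (coeffDerivation_map_C _) (coeffDerivation_map_C _) (coeffDerivation_map_C _)
    (by simpa using hr) hs
    (by
      simp only [map_neg, map_sub, map_mul, map_pow, map_one, map_ofNat, PowerSeries.map_X]
      linear_combination -e)
    (by
      intro h0
      have := congrArg PowerSeries.constantCoeff h0
      simp [hl', Derivation.leibniz, coeffDerivation_X, coeffDerivation_C_X] at this)
  simp only [hC, PowerSeries.map_X] at e₁ e₂
  exact ⟨s * PowerSeries.map (evalRingHom r) l, by linear_combination e₁,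
    by linear_combination e₂⟩

theorem exists_double_root_of_yInvariant {γ : PowerSeries ℚ} {Q₁ : PowerSeries ℚ[X]}
    (hS : yAxisSeries = PowerSeries.map C originSeries + PowerSeries.C X * Q₁)
    (h : yInvariant PowerSeries.X (PowerSeries.C X) (PowerSeries.map C originSeries)
      (PowerSeries.map C Aq) Q₁ =
        PowerSeries.X ^ 2 * (1 + PowerSeries.C X) ^ 3 * PowerSeries.map C γ) :
    ∃ u : PowerSeries ℚ,
      (u + 2 * PowerSeries.X ^ 2 * originSeries) + u ^ 3
          - 2 * (1 - PowerSeries.X ^ 2 * originSeries) * u ^ 2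
          + 4 * PowerSeries.X
            * (2 * PowerSeries.X - PowerSeries.X * originSeries - 2 * PowerSeries.X * Aq) * u
          = 8 * PowerSeries.X ^ 2 * γ ∧
        1 + 3 * u ^ 2 - 4 * (1 - PowerSeries.X ^ 2 * originSeries) * u
          + 4 * PowerSeries.X
            * (2 * PowerSeries.X - PowerSeries.X * originSeries - 2 * PowerSeries.X * Aq)
          = 0 := by
  obtain ⟨u, hu⟩ : ∃ u : PowerSeries ℚ[X], u = yNumerator PowerSeries.X (PowerSeries.C X)
    (PowerSeries.map C originSeries) Q₁ := ⟨_, rfl⟩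
  have e := mul_yInvariant (A := PowerSeries.map C Aq) hu
  rw [h] at e
  have hu' : u = PowerSeries.C X
      - PowerSeries.X * (PowerSeries.X * (1 + PowerSeries.C X) ^ 2 * yAxisSeries) := by
    rw [hu, hS, yNumerator]; ring
  have hC (f : PowerSeries ℚ) : PowerSeries.map (evalRingHom 1) (PowerSeries.map C f) = f := by
    ext n
    simp
  obtain ⟨e₁, e₂⟩ := double_root_of_y_equation coeffDerivation (PowerSeries.map (evalRingHom 1))
    (t := PowerSeries.X) (y := PowerSeries.C X) (u := u)
    (m := PowerSeries.map C (-(PowerSeries.X * originSeries)))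
    (α := PowerSeries.map C (-(1 - PowerSeries.X ^ 2 * originSeries)))
    (β := PowerSeries.map C
      (2 * PowerSeries.X - PowerSeries.X * originSeries - 2 * PowerSeries.X * Aq))
    (γ := PowerSeries.map C γ) coeffDerivation_X coeffDerivation_C_X (coeffDerivation_map_C _)
    (coeffDerivation_map_C _) (coeffDerivation_map_C _) (coeffDerivation_map_C _) (by simp)
    (by
      simp only [map_neg, map_sub, map_mul, map_pow, map_one, map_ofNat, PowerSeries.map_X]
      linear_combination -e)
    (by
      intro h0
      have := congrArg PowerSeries.constantCoeff h0
      simp only [hu', map_sub, Derivation.leibniz, coeffDerivation_X, coeffDerivation_C_X] at this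
      norm_num [map_ofNat] at this)
  simp only [hC, PowerSeries.map_X] at e₁ e₂
  exact ⟨PowerSeries.map (evalRingHom 1) u, by linear_combination e₁, by linear_combination e₂⟩

end Specialization

end Gessel

open PowerSeries in
/-- The quartic equation satisfied by `A = R′(0)`. -/
theorem gessel_Rprime0_quartic :
    729 * X ^ 6 * Aq ^ 4 + 243 * X ^ 4 * (4 * X ^ 2 + 1) * Aq ^ 3
      - 27 * X ^ 2 * (14 * X ^ 4 + 19 * X ^ 2 - 1) * Aq ^ 2
      - (20 * X ^ 2 - 1) * (7 * X ^ 2 - 6 * X + 1) * (7 * X ^ 2 + 6 * X + 1) * Aq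
      - X ^ 2 * (343 * X ^ 4 - 37 * X ^ 2 + 1) = (0 : PowerSeries ℚ) := by
  obtain ⟨R₂, hR⟩ := Gessel.exists_xAxisSeries_eq
  obtain ⟨Q₁, hS⟩ := Gessel.exists_yAxisSeries_eq
  obtain ⟨γ, hx, hy⟩ := Gessel.exists_invariants_eq hR hS
  obtain ⟨l₁, p₁, p₁'⟩ := Gessel.exists_double_root_of_xInvariant hR hx (s := 1) (r := 1)
    (by simp) (Or.inl rfl)
  obtain ⟨l₂, p₂, p₂'⟩ := Gessel.exists_double_root_of_xInvariant hR hx (s := -1) (r := -1)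
    (by simp) (Or.inr rfl)
  obtain ⟨u, p₃, p₃'⟩ := Gessel.exists_double_root_of_yInvariant hS hy
  have hφ := IsFractionRing.injective (PowerSeries ℚ) (FractionRing (PowerSeries ℚ))
  have : CharZero (PowerSeries ℚ) :=
    charZero_of_injective_algebraMap (algebraMap ℚ (PowerSeries ℚ)).injective
  have : CharZero (FractionRing (PowerSeries ℚ)) := charZero_of_injective_algebraMap hφ
  obtain ⟨φ, h⟩ : ∃ φ : PowerSeries ℚ →+* FractionRing (PowerSeries ℚ), Function.Injective φ :=
    ⟨_, hφ⟩
  have ht : φ X ≠ 0 := (map_ne_zero_iff φ h).mpr X_ne_zero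
  have hne (f : PowerSeries ℚ) {a : FractionRing (PowerSeries ℚ)} (hf : constantCoeff f = 0)
      (ha : φ f = a) : a ≠ 1 + 16 * φ X ^ 2 := by
    rintro rfl
    have h1 : f = 1 + 16 * X ^ 2 := h (by simpa [map_ofNat] using ha)
    simp [h1, map_ofNat] at hf
  apply h
  have q₁ := congrArg φ p₁
  have q₁' := congrArg φ p₁'
  have q₂ := congrArg φ p₂
  have q₂' := congrArg φ p₂'
  have q₃ := congrArg φ p₃
  have q₃' := congrArg φ p₃'
  simp only [map_add, map_sub, map_mul, map_pow, map_neg, map_one, map_zero, map_ofNat]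
    at q₁ q₁' q₂ q₂' q₃ q₃' ⊢
  refine Gessel.quartic_of_double_roots (m := -(φ X * φ Gessel.originSeries)) (γ := φ γ)
    (l₁ := φ l₁) (l₂ := φ l₂) (l₃ := φ u / (2 * φ X)) ht
    (hne (8 * X) (by simp) (by simp [map_ofNat]))
    (hne (-8 * X) (by simp) (by simp [map_ofNat]))
    (by linear_combination q₁) (by linear_combination q₁') (by linear_combination q₂)
    (by linear_combination q₂') ?_ ?_
  · field_simp
    linear_combination 4 * q₃
  · field_simp
    linear_combination 4 * q₃'
end

section
/- The series S = t·Q(0,0;t) satisfies, in ℚ[[t]], the equation 27t⁷S⁸ + 108t⁶S⁷ + 189t⁵S⁶ + 189t⁴S⁵ − 9t³(32t⁴+28t²−13)S⁴ − 9t²(64t⁴+56t²−5)S³ − 2t(256t⁶−312t⁴+156t²−5)S² − (32t²−1)(4t²−6t+1)(4t²+6t+1)S − t(256t⁶+576t⁴−48t²+1) = 0. Moreover Q(0,0;t) is algebraic of degree exactly 8 over ℚ(t): some nonzero polynomial in ℚ[t][z] of degree 8 in z annihilates Q(0,0;t), and no nonzero polynomial of degree less than 8 in z does. -/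
/-- `Q(0,0;t) = Σ_n q(0,0;n) tⁿ ∈ ℚ[[t]]`. -/
noncomputable def Q00q : PowerSeries ℚ :=
  PowerSeries.mk fun n => (gesselCount n 0 0 : ℚ)

/-- `S = t·Q(0,0;t)`. -/
noncomputable def Sq : PowerSeries ℚ := PowerSeries.X * Q00q

section Polynomials

open Polynomial

theorem gesselCount_eq_zero (n i j : ℕ) (h : n < i ∨ n < j) : gesselCount n i j = 0 := by
  induction n generalizing i j with
  | zero => rw [gesselCount, if_neg (by omega)]
  | succ n ih =>
    rw [gesselCount, ih (i + 1) j (by omega), ih (i + 1) (j + 1) (by omega)]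
    split_ifs <;> simp <;> (try constructor) <;> exact ih _ _ (by omega)

/-- The polynomial `Σ q(i,j;n) xⁱ yʲ`; the outer variable is `y`. -/
noncomputable def gesselPoly (n : ℕ) : Polynomial (Polynomial ℚ) :=
  ∑ j ∈ Finset.range (n + 1), monomial j
    (∑ i ∈ Finset.range (n + 1), monomial i (gesselCount n i j : ℚ))

theorem gesselPoly_coeff (n i j : ℕ) :
    ((gesselPoly n).coeff j).coeff i = (gesselCount n i j : ℚ) := by
  have h : (gesselPoly n).coeff j = if j < n + 1 then
      ∑ i ∈ Finset.range (n + 1), monomial i (gesselCount n i j : ℚ) else 0 := by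
    simp [gesselPoly, Polynomial.coeff_monomial]
  rw [h]
  split_ifs with hj
  · simp only [finsetSum_coeff, Polynomial.coeff_monomial, Finset.sum_ite_eq',
      Finset.mem_range]
    split_ifs with hi
    · rfl
    · rw [gesselCount_eq_zero n i j (by omega), Nat.cast_zero]
  · rw [gesselCount_eq_zero n i j (by omega), Nat.cast_zero, Polynomial.coeff_zero]

theorem gesselPoly_zero : gesselPoly 0 = 1 := by
  simp [gesselPoly, gesselCount]

theorem gesselPoly_succ (n : ℕ) :
    C X * X * gesselPoly (n + 1) = (1 + X) * (1 + C X ^ 2 * X) * gesselPoly n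
      - C ((gesselPoly n).coeff 0)
      - (1 + X) * ((gesselPoly n).map constantCoeff).map C
      + C (C (gesselCount n 0 0 : ℚ)) := by
  have e : (1 + X) * (1 + C X ^ 2 * X) * gesselPoly n = gesselPoly n + X * gesselPoly n
      + X * (C X * (C X * gesselPoly n)) + X * (X * (C X * (C X * gesselPoly n))) := by ring
  rw [e, mul_comm (C X) (X : ℚ[X][X]), mul_assoc, add_mul, one_mul]
  ext j i
  rcases j with _ | _ | j <;> rcases i with _ | _ | i <;>
    simp [gesselPoly_coeff, coeff_C, gesselCount] <;> ring

end Polynomials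

section Series

open PowerSeries

/-- The value at `a : S⟦X⟧` with zero constant term of the power series `f` over `R`, whose
coefficients are sent to `S⟦X⟧` by `φ`. -/
noncomputable def psEvalFun {R S : Type*} [CommRing R] [CommRing S] (φ : R →+* S⟦X⟧)
    (a : S⟦X⟧) (f : R⟦X⟧) : S⟦X⟧ :=
  PowerSeries.mk fun n => coeff n ((trunc (n + 1) f).eval₂ φ a)

theorem psEval_X_pow_dvd {R S : Type*} [CommRing R] [CommRing S] (φ : R →+* S⟦X⟧)
    {a : S⟦X⟧} (ha : X ∣ a) {N : ℕ} {p : Polynomial R} (hp : ∀ n < N, p.coeff n = 0) :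
    (X : S⟦X⟧) ^ N ∣ p.eval₂ φ a := by
  rw [Polynomial.eval₂_eq_sum, Polynomial.sum]
  refine Finset.dvd_sum fun i _ => ?_
  rcases lt_or_ge i N with h | h
  · simp [hp i h]
  · exact Dvd.dvd.mul_left ((pow_dvd_pow X h).trans (pow_dvd_pow_of_dvd ha i)) _

theorem psEvalFun_sub_dvd {R S : Type*} [CommRing R] [CommRing S] (φ : R →+* S⟦X⟧)
    {a : S⟦X⟧} (ha : X ∣ a) (f : R⟦X⟧) (N : ℕ) {p : Polynomial R}
    (hp : ∀ n < N, p.coeff n = coeff n f) :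
    (X : S⟦X⟧) ^ N ∣ psEvalFun φ a f - p.eval₂ φ a := by
  rw [X_pow_dvd_iff]
  intro m hm
  have h : (X : S⟦X⟧) ^ (m + 1) ∣ (trunc (m + 1) f - p).eval₂ φ a := by
    refine psEval_X_pow_dvd φ ha fun n hn => ?_
    rw [Polynomial.coeff_sub, coeff_trunc, if_pos hn, hp n (by omega), sub_self]
  rw [Polynomial.eval₂_sub, X_pow_dvd_iff] at h
  have := h m (Nat.lt_succ_self m)
  rw [map_sub] at this ⊢
  rw [psEvalFun, coeff_mk]
  exact this

theorem eq_of_forall_X_pow_dvd_sub {S : Type*} [CommRing S] {f g : S⟦X⟧}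
    (h : ∀ N, (X : S⟦X⟧) ^ N ∣ f - g) : f = g := by
  ext n
  have := (X_pow_dvd_iff.1 (h (n + 1))) n (Nat.lt_succ_self n)
  rwa [map_sub, sub_eq_zero] at this

/-- The ring homomorphism `R⟦X⟧ → S⟦X⟧` that is `φ` on coefficients and sends `X` to `a`. -/
noncomputable def psEval {R S : Type*} [CommRing R] [CommRing S] (φ : R →+* S⟦X⟧)
    (a : S⟦X⟧) (ha : X ∣ a) : R⟦X⟧ →+* S⟦X⟧ where
  toFun := psEvalFun φ a
  map_zero' := by ext n; simp [psEvalFun]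
  map_one' := by
    refine eq_of_forall_X_pow_dvd_sub fun N => ?_
    have := psEvalFun_sub_dvd φ ha 1 N (p := 1) fun n _ => by
      rw [coeff_one, Polynomial.coeff_one]
    simpa using this
  map_add' f g := by ext n; simp [psEvalFun]
  map_mul' f g := by
    refine eq_of_forall_X_pow_dvd_sub fun N => ?_
    have h1 := psEvalFun_sub_dvd φ ha f N (p := trunc N f) fun n hn => by
      rw [coeff_trunc, if_pos hn]
    have h2 := psEvalFun_sub_dvd φ ha g N (p := trunc N g) fun n hn => by
      rw [coeff_trunc, if_pos hn]
    have h3 := psEvalFun_sub_dvd φ ha (f * g) N (p := trunc N f * trunc N g) fun n hn => by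
      rw [coeff_mul_eq_coeff_trunc_mul_trunc _ _ hn, ← Polynomial.coe_mul, Polynomial.coeff_coe]
    rw [Polynomial.eval₂_mul] at h3
    obtain ⟨c1, h1⟩ := h1
    obtain ⟨c2, h2⟩ := h2
    obtain ⟨c3, h3⟩ := h3
    refine ⟨c3 - c1 * psEvalFun φ a g - c2 * (trunc N f).eval₂ φ a, ?_⟩
    linear_combination h3 - psEvalFun φ a g * h1 - (trunc N f).eval₂ φ a * h2

theorem psEval_C {R S : Type*} [CommRing R] [CommRing S] (φ : R →+* S⟦X⟧)
    (a : S⟦X⟧) (ha : X ∣ a) (r : R) : psEval φ a ha (C r) = φ r := by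
  refine eq_of_forall_X_pow_dvd_sub fun N => ?_
  have := psEvalFun_sub_dvd φ ha (C r) N (p := Polynomial.C r) fun n _ => by
    rw [coeff_C, Polynomial.coeff_C]
  rwa [Polynomial.eval₂_C] at this

theorem psEval_X {R S : Type*} [CommRing R] [CommRing S] (φ : R →+* S⟦X⟧)
    (a : S⟦X⟧) (ha : X ∣ a) : psEval φ a ha X = a := by
  refine eq_of_forall_X_pow_dvd_sub fun N => ?_
  have := psEvalFun_sub_dvd φ ha X N (p := Polynomial.X) fun n _ => by
    rw [coeff_X, Polynomial.coeff_X]; simp [eq_comm]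
  rwa [Polynomial.eval₂_X] at this

theorem exists_eq_C_add_X_mul {R : Type*} [CommRing R] (f : R⟦X⟧) :
    ∃ g, f = C (constantCoeff f) + X * g :=
  ⟨_, (eq_X_mul_shift_add_const f).trans (add_comm _ _)⟩

theorem exists_fixed_point {S : Type*} [CommRing S] (g : S⟦X⟧ → S⟦X⟧)
    (hg : ∀ a b, a - b ∣ g a - g b) : ∃ y, y = X * g y := by
  let it : ℕ → S⟦X⟧ := fun n => (fun y => X * g y)^[n] 0
  have hs : ∀ n, it (n + 1) = X * g (it n) := fun n => Function.iterate_succ_apply' _ _ _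
  have h1 : ∀ n, (X : S⟦X⟧) ^ n ∣ it (n + 1) - it n := by
    intro n
    induction n with
    | zero => simp
    | succ n ih =>
      have h : it (n + 1 + 1) - it (n + 1) = X * (g (it (n + 1)) - g (it n)) := by
        rw [hs (n + 1), hs n, mul_sub]
      rw [h, pow_succ']
      exact mul_dvd_mul_left _ (ih.trans (hg _ _))
  have h2 : ∀ n k, (X : S⟦X⟧) ^ n ∣ it (n + k) - it n := by
    intro n k
    induction k with
    | zero => simp
    | succ k ih =>
      have := dvd_add ((pow_dvd_pow X (Nat.le_add_right n k)).trans (h1 (n + k))) ih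
      rwa [sub_add_sub_cancel] at this
  let y : S⟦X⟧ := PowerSeries.mk fun n => coeff n (it (n + 1))
  have h3 : ∀ n, (X : S⟦X⟧) ^ n ∣ y - it n := by
    intro n
    rw [X_pow_dvd_iff]
    intro m hm
    obtain ⟨k, rfl⟩ := Nat.exists_eq_add_of_lt hm
    have := X_pow_dvd_iff.1 (h2 (m + 1) k) m (Nat.lt_succ_self m)
    rw [map_sub, sub_eq_zero] at this
    rw [map_sub, coeff_mk, sub_eq_zero, ← this]
    congr 2
    omega
  refine ⟨y, eq_of_forall_X_pow_dvd_sub fun N => ?_⟩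
  have h4 : (X : S⟦X⟧) ^ (N + 1) ∣ X * g (it N) - X * g y := by
    rw [← mul_sub, pow_succ']
    exact mul_dvd_mul_left _ (((dvd_sub_comm).1 (h3 N)).trans (hg _ _))
  rw [← hs N] at h4
  have h5 := dvd_add (h3 (N + 1)) h4
  rw [sub_add_sub_cancel] at h5
  exact (pow_dvd_pow X (Nat.le_succ N)).trans h5

/-- Coefficientwise derivative of a power series with polynomial coefficients. -/
noncomputable def coeffDeriv (f : (Polynomial ℚ)⟦X⟧) : (Polynomial ℚ)⟦X⟧ :=
  PowerSeries.mk fun n => Polynomial.derivative (coeff n f)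

theorem coeffDeriv_add (f g : (Polynomial ℚ)⟦X⟧) :
    coeffDeriv (f + g) = coeffDeriv f + coeffDeriv g := by
  ext1 n; simp [coeffDeriv]

theorem coeffDeriv_sub (f g : (Polynomial ℚ)⟦X⟧) :
    coeffDeriv (f - g) = coeffDeriv f - coeffDeriv g := by
  ext1 n; simp [coeffDeriv]

theorem coeffDeriv_mul (f g : (Polynomial ℚ)⟦X⟧) :
    coeffDeriv (f * g) = coeffDeriv f * g + f * coeffDeriv g := by
  ext1 n
  simp [coeffDeriv, coeff_mul, Polynomial.derivative_mul,
    Finset.sum_add_distrib]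

theorem coeffDeriv_map_C (s : ℚ⟦X⟧) : coeffDeriv (map Polynomial.C s) = 0 := by
  ext1 n; simp [coeffDeriv]

theorem coeffDeriv_C (p : Polynomial ℚ) : coeffDeriv (C p) = C (Polynomial.derivative p) := by
  ext1 n; simp only [coeffDeriv, coeff_mk, coeff_C]; split_ifs <;> simp

theorem coeffDeriv_X : coeffDeriv (X : (Polynomial ℚ)⟦X⟧) = 0 := by
  ext1 n; simp only [coeffDeriv, coeff_mk, coeff_X]; split_ifs <;> simp

/-- `Q(x,y;t)`. -/
noncomputable def gesselSeries : (Polynomial (Polynomial ℚ))⟦X⟧ := PowerSeries.mk gesselPoly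

/-- `Q(x,0;t)`. -/
noncomputable def gesselSeriesX : (Polynomial ℚ)⟦X⟧ :=
  PowerSeries.mk fun n => (gesselPoly n).coeff 0

/-- `Q(0,y;t)`. -/
noncomputable def gesselSeriesY : (Polynomial ℚ)⟦X⟧ :=
  PowerSeries.mk fun n => (gesselPoly n).map Polynomial.constantCoeff

theorem gesselSeries_eq :
    (C (Polynomial.C Polynomial.X) * C Polynomial.X
      - X * (1 + C Polynomial.X)
        * (1 + C (Polynomial.C Polynomial.X) ^ 2 * C Polynomial.X)) * gesselSeries
    = C (Polynomial.C Polynomial.X) * C Polynomial.X - X * map Polynomial.C gesselSeriesX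
      - X * (1 + C Polynomial.X) * map (Polynomial.mapRingHom Polynomial.C) gesselSeriesY
      + X * map Polynomial.C (map Polynomial.C Q00q) := by
  have h1 : gesselSeries = 1 + X * PowerSeries.mk fun n => gesselPoly (n + 1) := by
    conv_lhs => rw [eq_X_mul_shift_add_const gesselSeries]
    simp [gesselSeries, gesselPoly_zero, add_comm]
  have h2 : C (Polynomial.C Polynomial.X * Polynomial.X)
      * (PowerSeries.mk fun n => gesselPoly (n + 1))
      = C ((1 + Polynomial.X) * (1 + Polynomial.C Polynomial.X ^ 2 * Polynomial.X))
          * gesselSeries - map Polynomial.C gesselSeriesX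
        - C (1 + Polynomial.X) * map (Polynomial.mapRingHom Polynomial.C) gesselSeriesY
        + map Polynomial.C (map Polynomial.C Q00q) := by
    ext1 n
    rw [map_add (coeff n), map_sub (coeff n), map_sub (coeff n)]
    simp only [coeff_C_mul, coeff_mk, coeff_map, gesselSeries, gesselSeriesX,
      gesselSeriesY, Q00q, Polynomial.coe_mapRingHom]
    exact gesselPoly_succ n
  simp only [map_mul, map_add, map_pow, map_one] at h2
  linear_combination (C (Polynomial.C Polynomial.X) * C Polynomial.X) * h1 + X * h2

theorem eq_zero_of_eval₂_C_eq_zero {k : Type*} [Field k] {y : k⟦X⟧} (hy : X ∣ y) (hy0 : y ≠ 0)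
    {p : Polynomial k} (hp : p.eval₂ C y = 0) : p = 0 := by
  ext n
  induction n generalizing p with
  | zero =>
    obtain ⟨z, rfl⟩ := hy
    rw [← p.divX_mul_X_add] at hp
    have := congrArg constantCoeff hp
    simpa [Polynomial.eval₂_add, Polynomial.eval₂_mul] using this
  | succ n ih =>
    have h0 : p.coeff 0 = 0 := by
      obtain ⟨z, rfl⟩ := hy
      rw [← p.divX_mul_X_add] at hp
      have := congrArg constantCoeff hp
      simpa [Polynomial.eval₂_add, Polynomial.eval₂_mul] using this
    rw [← p.divX_mul_X_add, h0] at hp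
    simp only [map_zero, add_zero, Polynomial.eval₂_mul, Polynomial.eval₂_X, mul_eq_zero, hy0,
      or_false] at hp
    have := ih hp
    rwa [Polynomial.coeff_divX] at this

/-- The root `y = z (1 + y) (1 + x² y)` of the kernel, after the change of variables `t = x z`. -/
theorem exists_kernel_root :
    ∃ y : (Polynomial ℚ)⟦X⟧, y = X * ((1 + y) * (1 + C Polynomial.X ^ 2 * y)) :=
  exists_fixed_point (fun y => (1 + y) * (1 + C Polynomial.X ^ 2 * y)) fun a b =>
    ⟨1 + C Polynomial.X ^ 2 * (1 + a + b), by ring⟩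

/-- The root of the kernel. -/
noncomputable def kernelRoot : (Polynomial ℚ)⟦X⟧ := exists_kernel_root.choose

theorem kernelRoot_eq : kernelRoot
    = X * ((1 + kernelRoot) * (1 + C Polynomial.X ^ 2 * kernelRoot)) :=
  exists_kernel_root.choose_spec

theorem constantCoeff_kernelRoot : constantCoeff kernelRoot = 0 := by
  rw [kernelRoot_eq]; simp

theorem map_constantCoeff_kernelRoot_ne_zero :
    map (Polynomial.constantCoeff (R := ℚ)) kernelRoot ≠ 0 := by
  intro h
  have h2 := congrArg (map (Polynomial.constantCoeff (R := ℚ))) kernelRoot_eq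
  simp only [map_mul, map_add, map_X, map_one, h] at h2
  rw [mul_zero, add_zero, mul_one, mul_one] at h2
  exact X_ne_zero h2.symm

theorem kernelRoot_ne_zero : kernelRoot ≠ 0 := fun h =>
  map_constantCoeff_kernelRoot_ne_zero (by rw [h, map_zero])

/-- The substitution `x ↦ x`, `y ↦ kernelRoot`, `t ↦ x z`. -/
noncomputable def kernelSubst : (Polynomial (Polynomial ℚ))⟦X⟧ →+* (Polynomial ℚ)⟦X⟧ :=
  psEval (Polynomial.eval₂RingHom C kernelRoot) (C Polynomial.X * X) (Dvd.intro_left _ rfl)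

/-- The restriction of `kernelSubst` to series in `x` and `t`. -/
noncomputable def kernelSubstX : (Polynomial ℚ)⟦X⟧ →+* (Polynomial ℚ)⟦X⟧ :=
  kernelSubst.comp (map Polynomial.C)

/-- The restriction of `kernelSubst` to series in `y` and `t`. -/
noncomputable def kernelSubstY : (Polynomial ℚ)⟦X⟧ →+* (Polynomial ℚ)⟦X⟧ :=
  kernelSubst.comp (map (Polynomial.mapRingHom Polynomial.C))

theorem kernelSubst_X : kernelSubst X = C Polynomial.X * X := psEval_X _ _ _

theorem kernelSubst_C (p : Polynomial (Polynomial ℚ)) :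
    kernelSubst (C p) = p.eval₂ C kernelRoot := psEval_C _ _ _ _

theorem kernelSubstX_X : kernelSubstX X = C Polynomial.X * X := by
  simp [kernelSubstX, kernelSubst_X]

theorem kernelSubstY_X : kernelSubstY X = C Polynomial.X * X := by
  simp [kernelSubstY, kernelSubst_X]

theorem kernelSubstX_C (p : Polynomial ℚ) : kernelSubstX (C p) = C p := by
  simp [kernelSubstX, kernelSubst_C]

theorem kernelSubstY_C (p : Polynomial ℚ) :
    kernelSubstY (C p) = p.eval₂ (C.comp Polynomial.C) kernelRoot := by
  simp [kernelSubstY, kernelSubst_C, Polynomial.eval₂_map]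

theorem kernelSubstY_map_C (s : ℚ⟦X⟧) :
    kernelSubstY (map Polynomial.C s) = kernelSubstX (map Polynomial.C s) := by
  simp only [kernelSubstX, kernelSubstY, RingHom.comp_apply]
  congr 1
  ext1 n
  simp

theorem C_X_ne_zero : (C Polynomial.X : (Polynomial ℚ)⟦X⟧) ≠ 0 :=
  (map_ne_zero_iff C C_injective).2 Polynomial.X_ne_zero

theorem constantCoeff_eq_zero_of_kernelSubst_eq {A B : (Polynomial ℚ)⟦X⟧}
    (h : kernelSubstY B = (1 + kernelRoot) ^ 3 * kernelSubstX A)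
    (hA : ∀ n, (coeff n A).coeff 0 = 0) : constantCoeff A = 0 ∧ constantCoeff B = 0 := by
  obtain ⟨A', hA'⟩ := exists_eq_C_add_X_mul A
  obtain ⟨B', hB'⟩ := exists_eq_C_add_X_mul B
  have h0 := hA 0
  rw [coeff_zero_eq_constantCoeff_apply] at h0
  generalize constantCoeff A = a at *
  generalize constantCoeff B = b at *
  subst hA' hB'
  simp only [map_add, map_mul, kernelSubstX_X, kernelSubstY_X, kernelSubstX_C,
    kernelSubstY_C] at h
  have hb : b = 0 := by
    have := congrArg (map (Polynomial.constantCoeff (R := ℚ))) h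
    simp [h0, Polynomial.hom_eval₂] at this
    refine eq_zero_of_eval₂_C_eq_zero (y := map (Polynomial.constantCoeff (R := ℚ)) kernelRoot)
      ?_ map_constantCoeff_kernelRoot_ne_zero ?_
    · rw [X_dvd_iff]
      rw [← coeff_zero_eq_constantCoeff_apply, coeff_map, coeff_zero_eq_constantCoeff_apply,
        constantCoeff_kernelRoot, map_zero]
    · have e : (map (Polynomial.constantCoeff (R := ℚ))).comp (C.comp Polynomial.C) = C := by
        ext1 r
        simp
      rwa [e] at this
  refine ⟨?_, hb⟩
  rw [hb] at h
  have := congrArg constantCoeff h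
  simpa [constantCoeff_kernelRoot] using this.symm

theorem coeff_eq_zero_of_kernelSubst_eq (N : ℕ) {A B : (Polynomial ℚ)⟦X⟧}
    (h : kernelSubstY B = (1 + kernelRoot) ^ 3 * kernelSubstX A)
    (hA : ∀ n, (coeff n A).coeff 0 = 0) : coeff N A = 0 ∧ coeff N B = 0 := by
  induction N generalizing A B with
  | zero =>
    rw [coeff_zero_eq_constantCoeff_apply, coeff_zero_eq_constantCoeff_apply]
    exact constantCoeff_eq_zero_of_kernelSubst_eq h hA
  | succ N ih =>
    obtain ⟨A', hA'⟩ := exists_eq_C_add_X_mul A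
    obtain ⟨B', hB'⟩ := exists_eq_C_add_X_mul B
    rw [(constantCoeff_eq_zero_of_kernelSubst_eq h hA).1, map_zero, zero_add] at hA'
    rw [(constantCoeff_eq_zero_of_kernelSubst_eq h hA).2, map_zero, zero_add] at hB'
    subst hA' hB'
    rw [coeff_succ_X_mul, coeff_succ_X_mul]
    refine ih ?_ fun n => ?_
    · apply mul_left_cancel₀ (mul_ne_zero C_X_ne_zero X_ne_zero)
      rw [map_mul, map_mul, kernelSubstX_X, kernelSubstY_X] at h
      linear_combination h
    · rw [← coeff_succ_X_mul]
      exact hA (n + 1)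

theorem kernelSubst_functional_equation :
    C Polynomial.X * kernelRoot = C Polynomial.X * X * kernelSubstX gesselSeriesX
      + C Polynomial.X * X * (1 + kernelRoot) * kernelSubstY gesselSeriesY
      - C Polynomial.X * X * kernelSubstX (map Polynomial.C Q00q) := by
  have h := congrArg kernelSubst gesselSeries_eq
  simp only [map_mul, map_add, map_sub, map_pow, map_one, kernelSubst_X, kernelSubst_C,
    Polynomial.eval₂_C, Polynomial.eval₂_X] at h
  simp only [kernelSubstX, kernelSubstY, RingHom.comp_apply]
  linear_combination (C Polynomial.X * kernelSubst gesselSeries) * kernelRoot_eq - h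

theorem exists_eq_map_C_add_mul (f : (Polynomial ℚ)⟦X⟧) :
    ∃ g, f = map Polynomial.C (map Polynomial.constantCoeff f) + C Polynomial.X * g := by
  refine ⟨PowerSeries.mk fun n => (coeff n f).divX, ?_⟩
  ext1 n
  rw [map_add, coeff_C_mul, coeff_mk, coeff_map, coeff_map, add_comm]
  exact (Polynomial.X_mul_divX_add _).symm

theorem map_constantCoeff_gesselSeriesX : map Polynomial.constantCoeff gesselSeriesX = Q00q := by
  ext1 n
  simp [gesselSeriesX, Q00q, gesselPoly_coeff]

theorem map_constantCoeff_gesselSeriesY : map Polynomial.constantCoeff gesselSeriesY = Q00q := by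
  ext1 n
  simp [gesselSeriesY, Q00q, gesselPoly_coeff]

/-- The homogeneous cubic form attached to the equation between the two pairs of invariants. -/
def cubicForm {R : Type*} [CommRing R] (σ γ δ η m : R) : R :=
  η ^ 3 - (1 - σ) * m * η ^ 2 - γ * m ^ 2 * η - δ * m ^ 3

/-- The cubic forms in `x` and in `y` agree along the kernel curve. -/
theorem cubicForm_transfer {R : Type*} [CommRing R] [IsDomain R]
    {v t y q p k σ γ δ ρ η a b : R} (hv : v ≠ 0) (hy : y ≠ 0)
    (hk : y = t * ((1 + y) * (1 + v ^ 2 * y)))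
    (hfe : v * y = v * t * (q + v * p) + v * t * (1 + y) * (q + y * k) - v * t * q)
    (hσ : σ = (v * t) ^ 2 * q) (hρ : ρ = v * t + v * (v * t) ^ 2 * (v * p))
    (hη : η = y - (1 + y) ^ 2 * (σ + (v * t) ^ 2 * y * k))
    (ha : (ρ + σ * v) * (v * t * v ^ 2 + v * t) * (v - v * t * v ^ 2 - v * t)
      + cubicForm σ γ δ ρ v = v ^ 3 * a)
    (hb : (η + σ * (1 + y)) * ((v * t) ^ 2 * (1 - y ^ 2) ^ 2 + y ^ 2)
      + y * cubicForm σ γ δ η (1 + y) = y * b) : b = (1 + y) ^ 3 * a := by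
  have hfe' : y = t * (q + v * p) + t * (1 + y) * (q + y * k) - t * q :=
    mul_left_cancel₀ hv (by linear_combination hfe)
  let r := t + v * (v * t) ^ 2 * p
  have hρr : ρ = v * r := by rw [hρ]; ring
  have hηr : η = (1 + y) * r := by
    rw [hη, hσ]
    linear_combination ((1 + y) * v ^ 2 * t) * hfe' + hk
  have ha' : a = (r + σ) * (t * (1 + v ^ 2)) * (1 - t * (1 + v ^ 2)) + cubicForm σ γ δ r 1 := by
    apply mul_left_cancel₀ (pow_ne_zero 3 hv)
    rw [← ha, hρr]
    simp only [cubicForm]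
    ring
  apply mul_left_cancel₀ hy
  rw [← hb, ha', hηr]
  clear_value r
  simp only [cubicForm]
  clear ha hb ha' hfe hfe' hρr hηr hρ hη hσ
  linear_combination ((1 + y) * (r + σ) * (y - (1 + y) * (v ^ 2 * t + t * y))) * hk

/-- The invariants of Gessel's model satisfy a cubic equation, both in `x` and in `y`. -/
theorem exists_cubic_equation : ∃ γ δ : ℚ⟦X⟧, ∃ f g ρ η : (Polynomial ℚ)⟦X⟧,
    ρ = X + C Polynomial.X * X ^ 2 * f ∧ η = C Polynomial.X - X ^ 2 * g ∧
    cubicForm (map Polynomial.C (X ^ 2 * Q00q)) (map Polynomial.C γ) (map Polynomial.C δ)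
        ρ (C Polynomial.X)
      = -((ρ + map Polynomial.C (X ^ 2 * Q00q) * C Polynomial.X)
        * (X * C Polynomial.X ^ 2 + X) * (C Polynomial.X - X * C Polynomial.X ^ 2 - X)) ∧
    C Polynomial.X * cubicForm (map Polynomial.C (X ^ 2 * Q00q)) (map Polynomial.C γ)
        (map Polynomial.C δ) η (1 + C Polynomial.X)
      = -((η + map Polynomial.C (X ^ 2 * Q00q) * (1 + C Polynomial.X))
        * (X ^ 2 * (1 - C Polynomial.X ^ 2) ^ 2 + C Polynomial.X ^ 2)) := by
  obtain ⟨g1, h1⟩ := exists_eq_map_C_add_mul gesselSeriesX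
  obtain ⟨g2, h2⟩ := exists_eq_map_C_add_mul g1
  obtain ⟨g3, h3⟩ := exists_eq_map_C_add_mul g2
  obtain ⟨k1, h4⟩ := exists_eq_map_C_add_mul gesselSeriesY
  rw [map_constantCoeff_gesselSeriesX] at h1
  rw [map_constantCoeff_gesselSeriesY] at h4
  generalize map Polynomial.constantCoeff g1 = s1 at *
  generalize map Polynomial.constantCoeff g2 = s2 at *
  have hfe := kernelSubst_functional_equation
  have hk := kernelRoot_eq
  set Y := kernelRoot with hY
  have hY0 : Y ≠ 0 := kernelRoot_ne_zero
  let γ : ℚ⟦X⟧ := -2 * X ^ 2 + X ^ 2 * Q00q + 2 * X * (X ^ 2 * s1)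
  let δ : ℚ⟦X⟧ := X ^ 2 - 2 * X ^ 2 * (X ^ 2 * Q00q) - X * (X ^ 2 * s1)
    + 2 * X * (X ^ 2 * s1) * (X ^ 2 * Q00q) + 2 * X ^ 2 * (X ^ 2 * s2)
  let v : (Polynomial ℚ)⟦X⟧ := C Polynomial.X
  let t : (Polynomial ℚ)⟦X⟧ := X
  let ι : ℚ⟦X⟧ →+* (Polynomial ℚ)⟦X⟧ := map Polynomial.C
  let σ := ι (X ^ 2 * Q00q)
  have hγ : ι γ = -2 * t ^ 2 + σ + 2 * t * (t ^ 2 * ι s1) := by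
    simp [γ, σ, ι, t, map_ofNat]
  have hδ : ι δ = t ^ 2 - 2 * t ^ 2 * σ - t * (t ^ 2 * ι s1)
      + 2 * t * (t ^ 2 * ι s1) * σ + 2 * t ^ 2 * (t ^ 2 * ι s2) := by
    simp [δ, σ, ι, t, map_ofNat]
  have hσ : σ = t ^ 2 * ι Q00q := by
    simp [σ, ι, t]
  let ρ := t + v * t ^ 2 * (v * g1)
  let a := t ^ 2 * g1
  let A := v * (2 * t ^ 2 * (t ^ 2 * g3) + (t - 2 * (1 - σ) * t) * (t ^ 2 * g2)
    + (-t ^ 3 + σ * t - 2 * t ^ 2 * a + 3 * t * a ^ 2 - ι γ * a)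
    + v * (-σ * t ^ 2 + a * t - (1 - σ) * a ^ 2) + v ^ 2 * (-a * t ^ 2 + a ^ 3))
  have hA : (ρ + σ * v) * (t * v ^ 2 + t) * (v - t * v ^ 2 - t)
        + cubicForm σ (ι γ) (ι δ) ρ v = v ^ 3 * A := by
    change g1 = ι s1 + v * g2 at h2
    change g2 = ι s2 + v * g3 at h3
    clear_value γ δ σ ι v t
    simp only [ρ, A, a, hγ, hδ, cubicForm]
    clear hγ hδ ρ A a hσ h1 h4 hfe hk
    generalize ι s1 = r1 at *
    generalize ι s2 = r2 at *
    subst h2 h3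
    ring
  let η := v - (1 + v) ^ 2 * (σ + t ^ 2 * v * k1)
  let θ := 1 - σ * (1 + v) - (1 + v) ^ 2 * t ^ 2 * k1
  let B := θ * (t ^ 2 * (1 - v ^ 2) ^ 2 + v ^ 2) + cubicForm σ (ι γ) (ι δ) η (1 + v)
  have hB : (η + σ * (1 + v)) * (t ^ 2 * (1 - v ^ 2) ^ 2 + v ^ 2)
      + v * cubicForm σ (ι γ) (ι δ) η (1 + v) = v * B := by
    simp only [B, θ, η]
    ring
  have hAB : kernelSubstY B = (1 + Y) ^ 3 * kernelSubstX A := by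
    have hXv : kernelSubstX v = v := kernelSubstX_C _
    have hYv : kernelSubstY v = Y := by simp [v, kernelSubstY_C, Y]
    have hXt : kernelSubstX t = v * t := kernelSubstX_X
    have hYt : kernelSubstY t = v * t := kernelSubstY_X
    have hYι : ∀ s, kernelSubstY (ι s) = kernelSubstX (ι s) := kernelSubstY_map_C
    have hv0 : v ≠ 0 := C_X_ne_zero
    have hA' := congrArg kernelSubstX hA
    have hB' := congrArg kernelSubstY hB
    have hX1 := congrArg kernelSubstX h1
    have hY4 := congrArg kernelSubstY h4
    simp only [map_add, map_mul, map_sub, map_pow, map_one, hXv, hXt, hYv, hYt, hYι,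
      cubicForm] at hA' hB'
    simp only [map_add, map_mul] at hX1 hY4
    rw [show kernelSubstX (C Polynomial.X) = v from hXv] at hX1
    rw [show kernelSubstY (C Polynomial.X) = Y from hYv, kernelSubstY_map_C] at hY4
    rw [hX1, hY4] at hfe
    have hσX : kernelSubstX σ = (v * t) ^ 2 * kernelSubstX (ι Q00q) := by
      rw [hσ, map_mul, map_pow, hXt]
    have hσY : kernelSubstY σ = kernelSubstX σ := hYι _
    have hρ' : kernelSubstX ρ = v * t + v * (v * t) ^ 2 * (v * kernelSubstX g1) := by
      simp only [ρ, map_add, map_mul, map_pow, hXv, hXt]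
    have hη' : kernelSubstY η
        = Y - (1 + Y) ^ 2 * (kernelSubstX σ + (v * t) ^ 2 * Y * kernelSubstY k1) := by
      simp only [η, map_add, map_mul, map_pow, map_sub, map_one, hYv, hYt, hσY]
    rw [hσY] at hB'
    exact cubicForm_transfer hv0 hY0 hk hfe hσX hρ' hη' hA' hB'
  have hAc : ∀ n, (coeff n A).coeff 0 = 0 := by
    intro n
    simp only [A, v, coeff_C_mul, Polynomial.mul_coeff_zero, Polynomial.coeff_X_zero, zero_mul]
  have hA0 : A = 0 := by
    ext1 n
    rw [(coeff_eq_zero_of_kernelSubst_eq n hAB hAc).1, map_zero]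
  have hB0 : B = 0 := by
    ext1 n
    rw [(coeff_eq_zero_of_kernelSubst_eq n hAB hAc).2, map_zero]
  rw [hA0, mul_zero] at hA
  rw [hB0, mul_zero] at hB
  refine ⟨γ, δ, v * g1, (1 + v) ^ 2 * (ι Q00q + v * k1), ρ, η, rfl, ?_,
    eq_neg_of_add_eq_zero_right hA, eq_neg_of_add_eq_zero_right hB⟩
  simp only [η, hσ, v, t]
  ring

/-- Evaluation of the coefficients of a power series with polynomial coefficients at `a`. -/
noncomputable def coeffEval (a : ℚ⟦X⟧) : (Polynomial ℚ)⟦X⟧ →+* ℚ⟦X⟧ :=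
  psEval (Polynomial.eval₂RingHom C a) X dvd_rfl

theorem coeffEval_X (a : ℚ⟦X⟧) : coeffEval a X = X := psEval_X _ _ _

theorem coeffEval_C_X (a : ℚ⟦X⟧) : coeffEval a (C Polynomial.X) = a := by
  rw [coeffEval, psEval_C]
  simp

theorem coeffEval_map_C (a s : ℚ⟦X⟧) : coeffEval a (map Polynomial.C s) = s := by
  refine eq_of_forall_X_pow_dvd_sub fun N => ?_
  induction N generalizing s with
  | zero => simp
  | succ N ih =>
    obtain ⟨s', hs⟩ := exists_eq_C_add_X_mul s
    have h : coeffEval a (map Polynomial.C s) - s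
        = X * (coeffEval a (map Polynomial.C s') - s') := by
      rw [hs, map_add, map_mul, map_add, map_mul, map_X, coeffEval_X, map_C, coeffEval, psEval_C]
      simp
      ring
    rw [h, pow_succ']
    exact mul_dvd_mul_left _ (ih s')

instance : CharZero ℚ⟦X⟧ := charZero_of_injective_ringHom C_injective

/-- The discriminant of `cubicForm σ γ δ`. -/
def cubicDisc {R : Type*} [CommRing R] (σ γ δ : R) : R :=
  (1 - σ) ^ 2 * γ ^ 2 + 4 * γ ^ 3 - 4 * (1 - σ) ^ 3 * δ - 18 * (1 - σ) * γ * δ - 27 * δ ^ 2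

theorem cubicDisc_eq_zero {R : Type*} [CommRing R] [IsDomain R] [CharZero R] {σ γ δ η m p q : R}
    (h : cubicForm σ γ δ η m = 0)
    (h' : (3 * η ^ 2 - 2 * (1 - σ) * m * η - γ * m ^ 2) * p
      - ((1 - σ) * η ^ 2 + 2 * γ * m * η + 3 * δ * m ^ 2) * q = 0)
    (hm : m ≠ 0) (hd : p * m - q * η ≠ 0) : cubicDisc σ γ δ = 0 := by
  rw [cubicForm] at h
  have h2 : 3 * η ^ 2 - 2 * (1 - σ) * m * η - γ * m ^ 2 = 0 := by
    apply mul_right_cancel₀ hd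
    linear_combination m * h' - 3 * q * h
  rw [cubicDisc]
  generalize 1 - σ = b at *
  have h3 : (2 * b ^ 2 + 6 * γ) * η + (9 * δ + b * γ) * m = 0 := by
    apply mul_left_cancel₀ (pow_ne_zero 2 hm)
    linear_combination (3 * η - b * m) * h2 - 9 * h
  have h9 : (9 : R) ≠ 0 := by norm_num
  apply mul_left_cancel₀ (mul_ne_zero h9 (pow_ne_zero 2 hm))
  linear_combination (3 * ((2 * b ^ 2 + 6 * γ) * η - (9 * δ + b * γ) * m)
    - 2 * b * m * (2 * b ^ 2 + 6 * γ)) * h3 - (2 * b ^ 2 + 6 * γ) ^ 2 * h2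

theorem cubicDisc_eq_zero_of_square {σ γ δ : ℚ⟦X⟧} {η m l κ E : (Polynomial ℚ)⟦X⟧} (a : ℚ⟦X⟧)
    (h : l * cubicForm (map Polynomial.C σ) (map Polynomial.C γ) (map Polynomial.C δ) η m
      = κ ^ 2 * E)
    (hκ : coeffEval a κ = 0) (hl : coeffEval a l ≠ 0) (hm : coeffEval a m ≠ 0)
    (hd : coeffEval a (coeffDeriv η * m - coeffDeriv m * η) ≠ 0) : cubicDisc σ γ δ = 0 := by
  have h1 := congrArg (coeffEval a) h
  have h2 := congrArg (fun f => coeffEval a (coeffDeriv f)) h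
  simp only [coeffDeriv_mul, pow_two κ, map_add, map_mul, hκ] at h1 h2
  have h3 : coeffEval a
      (cubicForm (map Polynomial.C σ) (map Polynomial.C γ) (map Polynomial.C δ) η m) = 0 := by
    apply mul_left_cancel₀ hl
    linear_combination h1
  have h4 : coeffEval a (coeffDeriv
      (cubicForm (map Polynomial.C σ) (map Polynomial.C γ) (map Polynomial.C δ) η m)) = 0 := by
    apply mul_left_cancel₀ hl
    rw [h3] at h2
    linear_combination h2
  have h1' : coeffDeriv (1 : (Polynomial ℚ)⟦X⟧) = 0 := by
    rw [← map_one C, coeffDeriv_C, Polynomial.derivative_one, map_zero]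
  refine cubicDisc_eq_zero (η := coeffEval a η) (m := coeffEval a m)
    (p := coeffEval a (coeffDeriv η)) (q := coeffEval a (coeffDeriv m)) ?_ ?_ hm ?_
  · simpa only [cubicForm, map_sub, map_mul, map_pow, map_one, coeffEval_map_C] using h3
  · simp only [cubicForm, coeffDeriv_sub, coeffDeriv_mul, pow_succ, pow_zero, coeffDeriv_map_C,
      map_sub, map_add, map_mul, map_one, coeffEval_map_C, h1', map_zero] at h4
    linear_combination h4
  · simpa only [map_sub, map_mul] using hd

theorem cubicDisc_quarter {σ γ δ : ℚ⟦X⟧} {f ρ : (Polynomial ℚ)⟦X⟧}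
    (hρ : ρ = X + C Polynomial.X * X ^ 2 * f)
    (h : cubicForm (map Polynomial.C σ) (map Polynomial.C γ) (map Polynomial.C δ)
        ρ (C Polynomial.X)
      = -((ρ + map Polynomial.C σ * C Polynomial.X)
        * (X * C Polynomial.X ^ 2 + X) * (C Polynomial.X - X * C Polynomial.X ^ 2 - X)))
    {c : ℚ⟦X⟧} (hc : 2 * c = 1) : cubicDisc σ (γ - c ^ 2) (δ - c ^ 2 * σ) = 0 := by
  obtain ⟨a, ha⟩ := exists_fixed_point (S := ℚ) (fun y => 2 * (1 + y ^ 2)) fun a b =>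
    ⟨2 * (a + b), by ring⟩
  have ha0 : a ≠ 0 := by
    rintro rfl
    have h2 : (2 : ℚ⟦X⟧) ≠ 0 := two_ne_zero
    refine mul_ne_zero X_ne_zero h2 ?_
    linear_combination -ha
  have hc' : 2 * map Polynomial.C c = (1 : (Polynomial ℚ)⟦X⟧) := by
    have := congrArg (map Polynomial.C) hc
    rwa [map_mul, map_ofNat, map_one] at this
  refine cubicDisc_eq_zero_of_square (η := ρ) (m := C Polynomial.X) (l := 1)
    (κ := X * C Polynomial.X ^ 2 + X - map Polynomial.C c * C Polynomial.X)
    (E := ρ + map Polynomial.C σ * C Polynomial.X) a ?_ ?_ ?_ ?_ ?_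
  · rw [map_sub, map_sub, map_mul, map_pow]
    simp only [cubicForm] at h ⊢
    linear_combination h + ((ρ + map Polynomial.C σ * C Polynomial.X) * C Polynomial.X
      * (X * C Polynomial.X ^ 2 + X)) * hc'
  · simp only [map_sub, map_add, map_mul, map_pow, coeffEval_X, coeffEval_C_X, coeffEval_map_C]
    linear_combination (-c) * ha - (X * (1 + a ^ 2)) * hc
  · rw [map_one]; exact one_ne_zero
  · rwa [coeffEval_C_X]
  · intro h0
    simp only [hρ, coeffDeriv_add, coeffDeriv_mul, coeffDeriv_X, coeffDeriv_C, pow_two,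
      Polynomial.derivative_X, map_one, map_add, map_sub, map_mul, map_zero, coeffEval_X,
      coeffEval_C_X] at h0
    have h1 : (X : ℚ⟦X⟧) * (X * (a * a * coeffEval a (coeffDeriv f)) - 1) = 0 := by
      linear_combination h0
    have h2 := congrArg constantCoeff ((mul_eq_zero.1 h1).resolve_left X_ne_zero)
    simp at h2

theorem cubicDisc_of_sq_eq_one {σ γ δ : ℚ⟦X⟧} {g η : (Polynomial ℚ)⟦X⟧}
    (hη : η = C Polynomial.X - X ^ 2 * g)
    (h : C Polynomial.X * cubicForm (map Polynomial.C σ) (map Polynomial.C γ)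
        (map Polynomial.C δ) η (1 + C Polynomial.X)
      = -((η + map Polynomial.C σ * (1 + C Polynomial.X))
        * (X ^ 2 * (1 - C Polynomial.X ^ 2) ^ 2 + C Polynomial.X ^ 2)))
    {e : ℚ⟦X⟧} (he : e ^ 2 = 1) :
    cubicDisc σ (γ - (2 * e * X - 4 * X ^ 2)) (δ - (2 * e * X - 4 * X ^ 2) * σ) = 0 := by
  obtain ⟨a, ha⟩ := exists_fixed_point (S := ℚ) (fun y => e * (1 + y) ^ 2) fun a b =>
    ⟨e * (2 + a + b), by ring⟩
  have ha0 : a ≠ 0 := by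
    rintro rfl
    have he0 : e ≠ 0 := by
      rintro rfl
      simp at he
    refine mul_ne_zero X_ne_zero he0 ?_
    linear_combination -ha
  have he' : map Polynomial.C e ^ 2 = (1 : (Polynomial ℚ)⟦X⟧) := by
    rw [← map_pow, he, map_one]
  have hac : constantCoeff a = 0 := by rw [ha]; simp
  refine cubicDisc_eq_zero_of_square (η := η) (m := 1 + C Polynomial.X) (l := C Polynomial.X)
    (κ := map Polynomial.C e * X * (1 + C Polynomial.X) ^ 2 - C Polynomial.X)
    (E := -(η + map Polynomial.C σ * (1 + C Polynomial.X))) a ?_ ?_ ?_ ?_ ?_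
  · simp only [map_sub, map_mul, map_pow, map_ofNat, map_X]
    simp only [cubicForm] at h ⊢
    linear_combination h + ((η + map Polynomial.C σ * (1 + C Polynomial.X))
      * (X ^ 2 * (1 + C Polynomial.X) ^ 4)) * he'
  · simp only [map_sub, map_add, map_mul, map_pow, map_one, coeffEval_X, coeffEval_C_X,
      coeffEval_map_C]
    linear_combination -ha
  · rwa [coeffEval_C_X]
  · rw [map_add, map_one, coeffEval_C_X]
    intro h0
    have := congrArg constantCoeff h0
    simp [hac] at this
  · intro h0
    have h1' : coeffDeriv (1 : (Polynomial ℚ)⟦X⟧) = 0 := by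
      rw [← map_one C, coeffDeriv_C, Polynomial.derivative_one, map_zero]
    simp only [hη, coeffDeriv_add, coeffDeriv_sub, coeffDeriv_mul, coeffDeriv_X, coeffDeriv_C,
      pow_two, Polynomial.derivative_X, map_one, map_add, map_sub, map_mul, map_zero, coeffEval_X,
      coeffEval_C_X, h1'] at h0
    have h2 := congrArg constantCoeff h0
    simp [hac] at h2

theorem eq_of_cubic_roots {R : Type*} [CommRing R] [IsDomain R] {a b c d x y z : R}
    (hxy : x ≠ y) (hxz : x ≠ z) (hyz : y ≠ z) (hx : a * x ^ 3 + b * x ^ 2 + c * x + d = 0)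
    (hy : a * y ^ 3 + b * y ^ 2 + c * y + d = 0) (hz : a * z ^ 3 + b * z ^ 2 + c * z + d = 0) :
    b = -a * (x + y + z) ∧ c = a * (x * y + x * z + y * z) ∧ d = -a * (x * y * z) := by
  have h1 : a * (x ^ 2 + x * y + y ^ 2) + b * (x + y) + c = 0 :=
    mul_left_cancel₀ (sub_ne_zero.2 hxy) (by linear_combination hx - hy)
  have h2 : a * (x ^ 2 + x * z + z ^ 2) + b * (x + z) + c = 0 :=
    mul_left_cancel₀ (sub_ne_zero.2 hxz) (by linear_combination hx - hz)
  have hb : b = -a * (x + y + z) :=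
    mul_left_cancel₀ (sub_ne_zero.2 hyz) (by linear_combination h1 - h2)
  have hc : c = a * (x * y + x * z + y * z) := by linear_combination h1 - (x + y) * hb
  exact ⟨hb, hc, by linear_combination hx - x ^ 2 * hb - x * hc⟩

/-- The polynomial relation between `σ = t S` and `u = t²`. -/
def octic {R : Type*} [CommRing R] (u σ : R) : R :=
  27 * σ ^ 8 + 108 * σ ^ 7 + 189 * σ ^ 6 + 189 * σ ^ 5
    - 9 * (32 * u ^ 2 + 28 * u - 13) * σ ^ 4 - 9 * (64 * u ^ 2 + 56 * u - 5) * σ ^ 3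
    - 2 * (256 * u ^ 3 - 312 * u ^ 2 + 156 * u - 5) * σ ^ 2
    - (32 * u - 1) * (16 * u ^ 2 - 28 * u + 1) * σ - u * (256 * u ^ 3 + 576 * u ^ 2 - 48 * u + 1)

theorem octic_eq_zero_of_cubicDisc {R : Type*} [CommRing R] [IsDomain R] [CharZero R]
    {σ γ δ t w : R} (hw : 4 * w = 1) (h12 : (2 * 1 * t - 4 * t ^ 2) ≠ 2 * (-1) * t - 4 * t ^ 2)
    (h13 : 2 * 1 * t - 4 * t ^ 2 ≠ w) (h23 : 2 * (-1) * t - 4 * t ^ 2 ≠ w)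
    (h1 : cubicDisc σ (γ - (2 * 1 * t - 4 * t ^ 2)) (δ - (2 * 1 * t - 4 * t ^ 2) * σ) = 0)
    (h2 : cubicDisc σ (γ - (2 * (-1) * t - 4 * t ^ 2)) (δ - (2 * (-1) * t - 4 * t ^ 2) * σ) = 0)
    (h3 : cubicDisc σ (γ - w) (δ - w * σ) = 0) : octic (t ^ 2) σ = 0 := by
  have key : ∀ x : R, cubicDisc σ (γ - x) (δ - x * σ)
      = -4 * x ^ 3 + ((1 - σ) ^ 2 + 12 * γ - 18 * (1 - σ) * σ - 27 * σ ^ 2) * x ^ 2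
        + (-2 * (1 - σ) ^ 2 * γ - 12 * γ ^ 2 + 4 * (1 - σ) ^ 3 * σ + 18 * (1 - σ) * (δ + γ * σ)
          + 54 * δ * σ) * x + cubicDisc σ γ δ := by
    intro x
    simp only [cubicDisc]
    ring
  rw [key] at h1 h2 h3
  obtain ⟨hb, hc, hd⟩ := eq_of_cubic_roots h12 h13 h23 h1 h2 h3
  clear key h1 h2 h3 h12 h13 h23
  set g := 3 * γ with hg
  have hγ : g = 2 * σ ^ 2 + 5 * σ - 8 * t ^ 2 := by
    have h4 : (4 : R) ≠ 0 := by norm_num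
    apply mul_left_cancel₀ h4
    linear_combination hb + hw
  set n := 54 * (1 + 2 * σ) * δ with hn
  have hδ : n = -12 * (16 * t ^ 4 - 6 * t ^ 2) + 2 * (1 - σ) ^ 2 * g + 4 * g ^ 2
      - 12 * (1 - σ) ^ 3 * σ - 18 * (1 - σ) * g * σ := by
    linear_combination 3 * hc + 24 * t ^ 2 * hw
  have h : 324 * (1 - σ) ^ 2 * g ^ 2 * (1 + 2 * σ) ^ 2 + 432 * g ^ 3 * (1 + 2 * σ) ^ 2
      - 216 * (1 - σ) ^ 3 * (1 + 2 * σ) * n - 27 * n ^ 2 - 324 * (1 - σ) * (1 + 2 * σ) * g * n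
      - 11664 * (4 * t ^ 4 - t ^ 2) * (1 + 2 * σ) ^ 2 = 0 := by
    rw [cubicDisc] at hd
    linear_combination 2916 * (1 + 2 * σ) ^ 2 * hd
      + 2916 * (1 + 2 * σ) ^ 2 * (16 * t ^ 4 - 4 * t ^ 2) * hw
  rw [hδ, hγ] at h
  have h432 : (432 : R) ≠ 0 := by norm_num
  apply mul_left_cancel₀ h432
  rw [octic]
  linear_combination h

theorem octic_X_mul_Sq : octic (X ^ 2) (X * Sq) = 0 := by
  obtain ⟨γ, δ, f, g, ρ, η, hρ, hη, h1, h2⟩ := exists_cubic_equation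
  have hc : 2 * (C (1 / 2) : ℚ⟦X⟧) = 1 := by
    rw [← map_ofNat C, ← map_mul]
    norm_num
  rw [Sq, ← mul_assoc, ← pow_two]
  refine octic_eq_zero_of_cubicDisc (w := C (1 / 2) ^ 2) ?_ ?_ ?_ ?_
    (cubicDisc_of_sq_eq_one hη h2 (one_pow 2))
    (cubicDisc_of_sq_eq_one hη h2 (neg_one_sq)) (cubicDisc_quarter hρ h1 hc)
  · linear_combination (2 * C (1 / 2) + 1) * hc
  · intro h
    have h4 : (4 : ℚ⟦X⟧) ≠ 0 := by norm_num
    refine mul_ne_zero h4 X_ne_zero ?_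
    linear_combination h
  all_goals
    intro h
    have := congrArg constantCoeff h
    norm_num at this

theorem Sq_octic : 27 * X ^ 7 * Sq ^ 8 + 108 * X ^ 6 * Sq ^ 7 + 189 * X ^ 5 * Sq ^ 6
    + 189 * X ^ 4 * Sq ^ 5
    - 9 * X ^ 3 * (32 * X ^ 4 + 28 * X ^ 2 - 13) * Sq ^ 4
    - 9 * X ^ 2 * (64 * X ^ 4 + 56 * X ^ 2 - 5) * Sq ^ 3
    - 2 * X * (256 * X ^ 6 - 312 * X ^ 4 + 156 * X ^ 2 - 5) * Sq ^ 2
    - (32 * X ^ 2 - 1) * (4 * X ^ 2 - 6 * X + 1) * (4 * X ^ 2 + 6 * X + 1) * Sq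
    - X * (256 * X ^ 6 + 576 * X ^ 4 - 48 * X ^ 2 + 1) = (0 : ℚ⟦X⟧) := by
  have h := octic_X_mul_Sq
  rw [octic] at h
  apply mul_left_cancel₀ (X_ne_zero (R := ℚ))
  linear_combination h

end Series

section Degree

open Polynomial

theorem isUnit_mirror {R : Type*} [CommRing R] [IsDomain R] {f : R[X]} (h : IsUnit f) :
    IsUnit f.mirror := by
  obtain ⟨c, -, rfl⟩ := Polynomial.isUnit_iff.1 h
  rwa [mirror_C]

theorem irreducible_of_irreducible_mirror {R : Type*} [CommRing R] [IsDomain R] {f : R[X]}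
    (h : Irreducible f.mirror) : Irreducible f := by
  refine ⟨fun hf => h.not_isUnit (isUnit_mirror hf), fun a b hab => ?_⟩
  rw [hab, mirror_mul_of_domain] at h
  refine (h.isUnit_or_isUnit rfl).imp (fun ha => ?_) fun hb => ?_
  · rw [← a.mirror_mirror]
    exact isUnit_mirror ha
  · rw [← b.mirror_mirror]
    exact isUnit_mirror hb

/-- Eisenstein's criterion for the reversed polynomial. -/
theorem irreducible_of_reverse_eisenstein {R : Type*} [CommRing R] [IsDomain R] {f : R[X]}
    {P : Ideal R} (hP : P.IsPrime) (hf0 : f.coeff 0 ∉ P) (hfP : ∀ n, n ≠ 0 → f.coeff n ∈ P)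
    (hfd : 0 < f.natDegree) (hfl : f.leadingCoeff ∉ P ^ 2) (hu : f.IsPrimitive) :
    Irreducible f := by
  have h0 : f.coeff 0 ≠ 0 := fun h => hf0 (h ▸ P.zero_mem)
  have ht : f.natTrailingDegree = 0 := natTrailingDegree_eq_zero.2 (Or.inr h0)
  have hc : ∀ n, f.mirror.coeff n = f.coeff (revAt f.natDegree n) := fun n => by
    rw [coeff_mirror, ht, add_zero]
  have hd : f.mirror.natDegree = f.natDegree := f.mirror_natDegree
  have hne : f.mirror ≠ 0 := fun h => by
    rw [h, natDegree_zero] at hd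
    omega
  refine irreducible_of_irreducible_mirror (irreducible_of_eisenstein_criterion hP ?_ ?_ ?_ ?_ ?_)
  · rwa [mirror_leadingCoeff, trailingCoeff, ht]
  · intro n hn
    rw [degree_eq_natDegree hne, hd, Nat.cast_lt] at hn
    rw [hc, revAt_le hn.le]
    exact hfP _ (by omega)
  · rwa [← natDegree_pos_iff_degree_pos, hd]
  · rwa [hc, revAt_zero]
  · intro r hr
    refine hu r (C_dvd_iff_dvd_coeff _ _ |>.2 fun n => ?_)
    have := C_dvd_iff_dvd_coeff _ _ |>.1 hr (revAt f.natDegree n)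
    rwa [hc, revAt_invol] at this

/-- The degree of a monic irreducible polynomial vanishing at `s` is minimal. -/
theorem degree_le_of_monic_irreducible {R S : Type*} [CommRing R] [IsDomain R]
    [IsIntegrallyClosed R] [CommRing S] [IsDomain S] {φ : R →+* S} (hφ : Function.Injective φ)
    {s : S} {f p : R[X]} (hf : f.Monic) (hfi : Irreducible f) (hfs : f.eval₂ φ s = 0)
    (hp : p ≠ 0) (hps : p.eval₂ φ s = 0) : f.degree ≤ p.degree := by
  let _ := φ.toAlgebra
  have : FaithfulSMul R S := (faithfulSMul_iff_algebraMap_injective R S).2 hφ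
  have hs : IsIntegral R s := ⟨f, hf, hfs⟩
  have h1 : minpoly R s ∣ f := minpoly.isIntegrallyClosed_dvd hs hfs
  have h2 : Associated (minpoly R s) f :=
    (minpoly.irreducible hs).associated_of_dvd hfi h1
  rw [← degree_eq_degree_of_associated h2]
  exact minpoly.IsIntegrallyClosed.degree_le_of_ne_zero hp hps

/-- The value of `octic` at `u = -1`, divided by `9`. -/
theorem irreducible_octic_neg_one :
    Irreducible (C 3 * (X ^ 8 + 4 * X ^ 7 + 7 * X ^ 6 + 7 * X ^ 5 + 3 * X ^ 4 - X ^ 3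
      + 54 * X ^ 2 + 55 * X) + C 41 : GaussianInt[X]) := by
  set p : GaussianInt[X] := X ^ 8 + 4 * X ^ 7 + 7 * X ^ 6 + 7 * X ^ 5 + 3 * X ^ 4 - X ^ 3
    + 54 * X ^ 2 + 55 * X with hp
  have h3 : Prime (3 : GaussianInt) := by
    have : Fact (Nat.Prime 3) := ⟨Nat.prime_three⟩
    exact_mod_cast GaussianInt.prime_of_nat_prime_of_mod_four_eq_three 3 rfl
  have hc0 : (C 3 * p + C 41).coeff 0 = 41 := by simp [hp]
  have hd : (C 3 * p + C 41).natDegree = 8 := by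
    rw [hp]
    compute_degree!
  have hc8 : (C 3 * p + C 41).coeff 8 = 3 := by
    rw [hp]
    compute_degree!
  refine irreducible_of_reverse_eisenstein (P := Ideal.span {3})
    ((Ideal.span_singleton_prime h3.ne_zero).2 h3) ?_ ?_ ?_ ?_ ?_
  · rw [hc0, Ideal.mem_span_singleton]
    intro h
    refine h3.not_isUnit (isUnit_of_dvd_one ?_)
    have := dvd_sub (Dvd.intro 14 rfl : (3 : GaussianInt) ∣ 3 * 14) h
    norm_num at this
    exact this
  · intro n hn
    rw [coeff_add, coeff_C_mul, coeff_C, if_neg hn, add_zero]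
    exact Ideal.mul_mem_right _ _ (Ideal.mem_span_singleton_self _)
  · rw [hd]
    norm_num
  · rw [leadingCoeff, hd, hc8, Ideal.span_singleton_pow, Ideal.mem_span_singleton]
    rintro ⟨c, hc⟩
    refine h3.not_isUnit (IsUnit.of_mul_eq_one c ?_)
    apply mul_left_cancel₀ h3.ne_zero
    linear_combination -hc
  · intro r hr
    rw [C_dvd_iff_dvd_coeff] at hr
    have h0 := hr 0
    have h8 := hr 8
    rw [hc0] at h0
    rw [hc8] at h8
    refine isUnit_of_dvd_one ?_
    have := dvd_sub (h8.mul_right 14) h0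
    norm_num at this
    exact this

theorem map_octic {R S : Type*} [CommRing R] [CommRing S] (φ : R →+* S) (u σ : R) :
    φ (octic u σ) = octic (φ u) (φ σ) := by
  simp [octic, map_ofNat]

theorem natDegree_octic {R : Type*} [CommRing R] [IsDomain R] [CharZero R] (u : R) {c : R}
    (hc : c ≠ 0) : (octic (C u) (C c * X)).natDegree = 8 := by
  have h : 27 * c ^ 8 ≠ 0 := mul_ne_zero (by norm_num) (pow_ne_zero 8 hc)
  rw [octic]
  compute_degree!

theorem leadingCoeff_octic {R : Type*} [CommRing R] [IsDomain R] [CharZero R] (u : R) :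
    (octic (C u) X).leadingCoeff = 27 := by
  have h := natDegree_octic u (one_ne_zero (α := R))
  rw [C_1, one_mul] at h
  rw [leadingCoeff, h, octic]
  compute_degree!

/-- The monic polynomial over `ℚ[t]` that vanishes at `t S`. -/
noncomputable def monicOctic : ℚ[X][X] := C (C (1 / 27)) * octic (C (X ^ 2 : ℚ[X])) X

theorem monicOctic_monic : monicOctic.Monic := by
  rw [Monic, monicOctic, leadingCoeff_mul, leadingCoeff_C, leadingCoeff_octic,
    ← map_ofNat (C : ℚ →+* ℚ[X]), ← map_mul]
  norm_num

theorem degree_monicOctic : monicOctic.degree = 8 := by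
  have h := natDegree_octic (X ^ 2 : ℚ[X]) one_ne_zero
  rw [C_1, one_mul] at h
  rw [degree_eq_natDegree monicOctic_monic.ne_zero, monicOctic,
    natDegree_C_mul (C_ne_zero.2 (by norm_num)), h]
  rfl

theorem irreducible_monicOctic : Irreducible monicOctic := by
  let K := FractionRing GaussianInt
  let i : K := algebraMap GaussianInt K ⟨0, 1⟩
  have hi : i ^ 2 = -1 := by
    rw [← map_pow, ← map_one (algebraMap GaussianInt K), ← map_neg]
    congr 1
  have : CharZero K := charZero_of_injective_algebraMap (IsFractionRing.injective GaussianInt K)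
  let φ : ℚ[X] →+* K := eval₂RingHom (algebraMap ℚ K) i
  refine monicOctic_monic.irreducible_of_irreducible_map φ _ ?_
  have h := irreducible_octic_neg_one
  have hprim := h.isPrimitive (by
    rw [natDegree_add_C, natDegree_C_mul (by norm_num)]
    refine ne_of_eq_of_ne (b := 8) ?_ (by norm_num)
    compute_degree!)
  rw [hprim.irreducible_iff_irreducible_map_fraction_map (K := K)] at h
  have h3 : IsUnit (C (1 / 3) : K[X]) := isUnit_C.2 (IsUnit.mk0 _ (by norm_num))
  rw [← irreducible_isUnit_mul h3] at h
  convert h using 1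
  have hX : φ (X ^ 2) = -1 := by
    simp only [φ, coe_eval₂RingHom, eval₂_pow, eval₂_X, hi]
  have hc : φ (C (1 / 27)) = 1 / 27 := by
    simp only [φ, coe_eval₂RingHom, eval₂_C, map_div₀, map_one, map_ofNat]
  have h9 : (C (1 / 3) : K[X]) = 9 * C (1 / 27) := by
    rw [← map_ofNat (C : K →+* K[X]), ← map_mul]
    norm_num
  rw [monicOctic, Polynomial.map_mul, ← coe_mapRingHom, map_octic, coe_mapRingHom, map_C, map_C,
    map_X, hX, hc, C_neg, C_1, h9, octic]
  simp only [Polynomial.map_add, Polynomial.map_sub, Polynomial.map_mul, Polynomial.map_pow,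
    map_X, Polynomial.map_ofNat, map_ofNat]
  ring

theorem eval₂_Q00q_ne_zero_of_degree_lt {P : ℚ[X][X]} (hP : P ≠ 0) (hd : P.degree < 8) :
    P.eval₂ Polynomial.coeToPowerSeries.ringHom Q00q ≠ 0 := by
  intro h
  have h1 := scaleRoots_eval₂_eq_zero coeToPowerSeries.ringHom (s := (X ^ 2 : ℚ[X])) h
  have h2 : monicOctic.eval₂ coeToPowerSeries.ringHom
      (coeToPowerSeries.ringHom (X ^ 2) * Q00q) = 0 := by
    have h3 := octic_X_mul_Sq
    rw [monicOctic, eval₂_mul, ← coe_eval₂RingHom, map_octic, coe_eval₂RingHom, eval₂_C, eval₂_C,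
      eval₂_X]
    rw [Sq, ← mul_assoc, ← pow_two] at h3
    simp only [map_pow, coeToPowerSeries.ringHom_apply, coe_X]
    rw [h3, mul_zero]
  have h4 := degree_le_of_monic_irreducible (coe_injective ℚ) monicOctic_monic
    irreducible_monicOctic h2 (scaleRoots_ne_zero hP _) h1
  rw [degree_scaleRoots, degree_monicOctic] at h4
  exact absurd hd h4.not_gt

theorem exists_degree_eq_eight : ∃ P : ℚ[X][X], P ≠ 0 ∧ P.degree = 8 ∧
    P.eval₂ Polynomial.coeToPowerSeries.ringHom Q00q = 0 := by
  have h := natDegree_octic (X ^ 2 : ℚ[X]) (pow_ne_zero 2 X_ne_zero)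
  have h0 : octic (C (X ^ 2 : ℚ[X])) (C (X ^ 2) * X) ≠ 0 := fun h0 => by
    rw [h0, natDegree_zero] at h
    omega
  refine ⟨_, h0, ?_, ?_⟩
  · rw [degree_eq_natDegree h0, h]
    rfl
  · rw [← coe_eval₂RingHom, map_octic, map_mul, coe_eval₂RingHom, eval₂_C, eval₂_X]
    simp only [map_pow, coeToPowerSeries.ringHom_apply, coe_X]
    have h3 := octic_X_mul_Sq
    rwa [Sq, ← mul_assoc, ← pow_two] at h3

end Degree

open PowerSeries in
/-- The octic equation satisfied by `S = t Q(0,0;t)`, and the fact that `Q(0,0;t)` is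
algebraic of degree exactly `8` over `ℚ(t)`: it is annihilated by a nonzero polynomial
of degree `8` in `z` with coefficients in `ℚ[t]`, and by no nonzero polynomial of
smaller degree. -/
theorem gessel_Q00_octic :
    (27 * X ^ 7 * Sq ^ 8 + 108 * X ^ 6 * Sq ^ 7 + 189 * X ^ 5 * Sq ^ 6
        + 189 * X ^ 4 * Sq ^ 5
        - 9 * X ^ 3 * (32 * X ^ 4 + 28 * X ^ 2 - 13) * Sq ^ 4
        - 9 * X ^ 2 * (64 * X ^ 4 + 56 * X ^ 2 - 5) * Sq ^ 3
        - 2 * X * (256 * X ^ 6 - 312 * X ^ 4 + 156 * X ^ 2 - 5) * Sq ^ 2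
        - (32 * X ^ 2 - 1) * (4 * X ^ 2 - 6 * X + 1) * (4 * X ^ 2 + 6 * X + 1) * Sq
        - X * (256 * X ^ 6 + 576 * X ^ 4 - 48 * X ^ 2 + 1) = (0 : PowerSeries ℚ)) ∧
    (∃ P : Polynomial (Polynomial ℚ), P ≠ 0 ∧ P.degree = 8 ∧
        Polynomial.eval₂ Polynomial.coeToPowerSeries.ringHom Q00q P = 0) ∧
    (∀ P : Polynomial (Polynomial ℚ), P ≠ 0 → P.degree < 8 →
        Polynomial.eval₂ Polynomial.coeToPowerSeries.ringHom Q00q P ≠ 0) :=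
  ⟨Sq_octic, exists_degree_eq_eight, fun _ hP hd => eval₂_Q00q_ne_zero_of_degree_lt hP hd⟩
end
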